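/- arXiv:1609.04473 — 3 statements merged into one kernel-verified Lean document; each statement's English description precedes it below -/
import Mathlib

section
/- (Position of the critical point) For a Lorenz map g let ρ(g) = c(g)/(1 − c(g)) be its relative critical point and ν(g) = g_-(c(g))/(1 − g_+(c(g))) its relative critical value. If f ∈ L_δ is an (a,b)-renormalizable Lorenz map, then ρ(Rf)^α / ν(Rf) = κ · (ρ(f)^α / ν(f)) · Df^b(x)/Df^a(y) for some x ∈ f(C_+), some y ∈ f(C_-) and some κ with e^{−2δ} ≤ κ ≤ e^{2δ}, where Df^k denotes the derivative of the k-th iterate of f. -/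
open Set Filter Topology MeasureTheory Function

noncomputable section

/-- The nonlinearity `Nφ = D log Dφ = φ''/φ'`. -/
def nonlinearity (φ : ℝ → ℝ) : ℝ → ℝ := fun x => deriv (deriv φ) x / deriv φ x

/-- The Schwarzian derivative `Sφ = D(Nφ) - (Nφ)²/2`. -/
def schwarzian (φ : ℝ → ℝ) : ℝ → ℝ := fun x =>
  deriv (nonlinearity φ) x - (nonlinearity φ x) ^ 2 / 2

/-- `φ` is an orientation-preserving C³ diffeomorphism of `[0,1]` with
nonpositive Schwarzian derivative. -/
structure IsSDiffeo (φ : ℝ → ℝ) : Prop where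
  contDiff : ContDiffOn ℝ 3 φ (Icc 0 1)
  fix0 : φ 0 = 0
  fix1 : φ 1 = 1
  derivPos : ∀ x ∈ Icc (0:ℝ) 1, 0 < deriv φ x
  schwNonpos : ∀ x ∈ Icc (0:ℝ) 1, schwarzian φ x ≤ 0

/-- The nonlinearity norm `‖φ‖ = sup |Nφ|` over `[0,1]`. -/
def diffeoNorm (φ : ℝ → ℝ) : ℝ := sSup ((fun x => |nonlinearity φ x|) '' Icc 0 1)

/-- Left branch of the standard family: `q₋(x) = u (1 - |(c-x)/c|^α)`. -/
def qminus (α u c : ℝ) : ℝ → ℝ := fun x => u * (1 - |(c - x) / c| ^ α)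

/-- Right branch of the standard family: `q₊(x) = 1 + v (-1 + |(x-c)/(1-c)|^α)`. -/
def qplus (α v c : ℝ) : ℝ → ℝ := fun x => 1 + v * (-1 + |(x - c) / (1 - c)| ^ α)

/-- A Lorenz map with critical exponent `α`: a tuple `(u,v,c,φ,ψ)` with
branches `f₋ = φ ∘ q₋` on `[0,c)` and `f₊ = ψ ∘ q₊` on `(c,1]`, such that
`x < f₋(x)` on `(0,c]` and `f₊(x) < x` on `[c,1)`. -/
structure LorenzMap (α : ℝ) where
  u : ℝ
  v : ℝ
  c : ℝ
  φ : ℝ → ℝ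
  ψ : ℝ → ℝ
  hu : u ∈ Icc (0:ℝ) 1
  hv : v ∈ Icc (0:ℝ) 1
  hc : c ∈ Ioo (0:ℝ) 1
  hφ : IsSDiffeo φ
  hψ : IsSDiffeo ψ
  hleft : ∀ x ∈ Ioc (0:ℝ) c, x < φ (qminus α u c x)
  hright : ∀ x ∈ Ico c (1:ℝ), ψ (qplus α v c x) < x

namespace LorenzMap

variable {α : ℝ}

/-- The left branch `f₋ = φ ∘ q₋`. -/
def fm (f : LorenzMap α) : ℝ → ℝ := fun x => f.φ (qminus α f.u f.c x)

/-- The right branch `f₊ = ψ ∘ q₊`. -/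
def fp (f : LorenzMap α) : ℝ → ℝ := fun x => f.ψ (qplus α f.v f.c x)

/-- The Lorenz map as a function (its value at the critical point itself is
irrelevant; we use the right branch there). -/
def toFun (f : LorenzMap α) : ℝ → ℝ := fun x => if x < f.c then f.fm x else f.fp x

/-- `f ∈ L_δ`: both diffeomorphic parts have nonlinearity norm `< δ`. -/
def memL (f : LorenzMap α) (δ : ℝ) : Prop := diffeoNorm f.φ < δ ∧ diffeoNorm f.ψ < δ

/-- The preimage `f₋⁻¹(y)` of a point under the left branch, taken in `[0, c]`. -/
def fmInv (f : LorenzMap α) : ℝ → ℝ := fun y => invFunOn f.fm (Icc 0 f.c) y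

/-- The preimage `f₊⁻¹(y)` of a point under the right branch, taken in `[c, 1]`. -/
def fpInv (f : LorenzMap α) : ℝ → ℝ := fun y => invFunOn f.fp (Icc f.c 1) y

end LorenzMap

/-- First return time of `x` to `C` under `F`. -/
def firstReturn (F : ℝ → ℝ) (C : Set ℝ) (x : ℝ) : ℕ := sInf {k : ℕ | 0 < k ∧ F^[k] x ∈ C}

/-- `[l,r] ⊊ [0,1]` is a renormalization interval for `f`, whose first-return map
is affinely conjugate to the Lorenz map `g`. -/
def IsRenormPair {α : ℝ} (f g : LorenzMap α) (l r : ℝ) : Prop :=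
  0 ≤ l ∧ l < f.c ∧ f.c < r ∧ r ≤ 1 ∧ (0 < l ∨ r < 1) ∧
  g.c = (f.c - l) / (r - l) ∧
  ∀ x ∈ Icc l r, x ≠ f.c →
    (∃ k, 0 < k ∧ f.toFun^[k] x ∈ Icc l r) ∧
    f.toFun^[firstReturn f.toFun (Icc l r) x] x = l + (r - l) * g.toFun ((x - l) / (r - l))

/-- `f` is renormalizable. -/
def Renormalizable {α : ℝ} (f : LorenzMap α) : Prop := ∃ g l r, IsRenormPair f g l r

/-- `[l,r]` is the return interval of `f`: the largest renormalization interval. -/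
def IsReturnInterval {α : ℝ} (f : LorenzMap α) (l r : ℝ) : Prop :=
  (∃ g, IsRenormPair f g l r) ∧
  ∀ g' l' r', IsRenormPair f g' l' r' → Icc l' r' ⊆ Icc l r

/-- `g = R f` is the renormalization of `f` (rescaled first-return map to the
return interval). -/
def IsRenormalizationOf {α : ℝ} (f g : LorenzMap α) : Prop :=
  ∃ l r, IsReturnInterval f l r ∧ IsRenormPair f g l r

/-- The `(a,b)` combinatorics of renormalization on the interval `[l,r]`, where
`C₋ = [l,c)` and `C₊ = (c,r]`:
`f(C₋) > f²(C₋) > ⋯ > f^a(C₋) > c`, `C₋ ⊂ f^(a+1)(C₋) ⊂ C`, and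
`f(C₊) < f²(C₊) < ⋯ < f^b(C₊) < c`, `C₊ ⊂ f^(b+1)(C₊) ⊂ C`. -/
def ABCombinatorics {α : ℝ} (f : LorenzMap α) (l r : ℝ) (a b : ℕ) : Prop :=
  0 < a ∧ 0 < b ∧
  (∀ i, 1 ≤ i → i ≤ a → ∀ x ∈ Ico l f.c, f.c < f.toFun^[i] x) ∧
  (∀ i, 1 ≤ i → i + 1 ≤ a → ∀ x ∈ Ico l f.c, ∀ y ∈ Ico l f.c,
    f.toFun^[i+1] x < f.toFun^[i] y) ∧
  Ico l f.c ⊆ f.toFun^[a+1] '' Ico l f.c ∧ f.toFun^[a+1] '' Ico l f.c ⊆ Icc l r ∧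
  (∀ i, 1 ≤ i → i ≤ b → ∀ x ∈ Ioc f.c r, f.toFun^[i] x < f.c) ∧
  (∀ i, 1 ≤ i → i + 1 ≤ b → ∀ x ∈ Ioc f.c r, ∀ y ∈ Ioc f.c r,
    f.toFun^[i] x < f.toFun^[i+1] y) ∧
  Ioc f.c r ⊆ f.toFun^[b+1] '' Ioc f.c r ∧ f.toFun^[b+1] '' Ioc f.c r ⊆ Icc l r

/-- `f` is `(a,b)`-renormalizable with return interval `[l,r]`. -/
def ABRenormWith {α : ℝ} (f : LorenzMap α) (a b : ℕ) (l r : ℝ) : Prop :=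
  IsReturnInterval f l r ∧ ABCombinatorics f l r a b

/-- `f` is `(a,b)`-renormalizable. -/
def ABRenormalizable {α : ℝ} (f : LorenzMap α) (a b : ℕ) : Prop :=
  ∃ l r, ABRenormWith f a b l r

/-- A sequence of successive renormalizations: `F (k+1) = R (F k)`. -/
def RenormSeq {α : ℝ} (F : ℕ → LorenzMap α) : Prop :=
  ∀ k, IsRenormalizationOf (F k) (F (k + 1))

/-! ### Helper lemmas -/

namespace IsSDiffeo

variable {φ : ℝ → ℝ}

lemma diffAt (h : IsSDiffeo φ) {x : ℝ} (hx : x ∈ Icc (0:ℝ) 1) : DifferentiableAt ℝ φ x :=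
  differentiableAt_of_deriv_ne_zero (h.derivPos x hx).ne'

lemma contOn (h : IsSDiffeo φ) : ContinuousOn φ (Icc 0 1) := h.contDiff.continuousOn

lemma strictMono (h : IsSDiffeo φ) : StrictMonoOn φ (Icc 0 1) := by
  refine strictMonoOn_of_deriv_pos (convex_Icc 0 1) h.contOn fun x hx => ?_
  exact h.derivPos x (interior_subset hx)

lemma mapsTo (h : IsSDiffeo φ) {x : ℝ} (hx : x ∈ Icc (0:ℝ) 1) : φ x ∈ Icc (0:ℝ) 1 := by
  constructor
  · rw [← h.fix0]
    exact h.strictMono.monotoneOn (by simp) hx hx.1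
  · rw [← h.fix1]
    exact h.strictMono.monotoneOn hx (by simp) hx.2

lemma derivWithin_eq (h : IsSDiffeo φ) {x : ℝ} (hx : x ∈ Icc (0:ℝ) 1) :
    derivWithin φ (Icc 0 1) x = deriv φ x :=
  (h.diffAt hx).derivWithin (uniqueDiffOn_Icc zero_lt_one x hx)

lemma contDiff_D (h : IsSDiffeo φ) : ContDiffOn ℝ 2 (derivWithin φ (Icc 0 1)) (Icc 0 1) :=
  h.contDiff.derivWithin (uniqueDiffOn_Icc zero_lt_one) (by norm_num)

lemma contOn_deriv (h : IsSDiffeo φ) : ContinuousOn (deriv φ) (Icc 0 1) :=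
  h.contDiff_D.continuousOn.congr fun _ hx => (h.derivWithin_eq hx).symm

lemma eventually_D {x : ℝ} (h : IsSDiffeo φ) (hx : x ∈ Ioo (0:ℝ) 1) :
    deriv φ =ᶠ[𝓝 x] derivWithin φ (Icc 0 1) := by
  filter_upwards [Ioo_mem_nhds hx.1 hx.2] with y hy
  exact (h.derivWithin_eq (Ioo_subset_Icc_self hy)).symm

lemma diffAt_D {x : ℝ} (h : IsSDiffeo φ) (hx : x ∈ Ioo (0:ℝ) 1) :
    DifferentiableAt ℝ (derivWithin φ (Icc 0 1)) x :=
  (h.contDiff_D.differentiableOn (by norm_num) x (Ioo_subset_Icc_self hx)).differentiableAt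
    (Icc_mem_nhds hx.1 hx.2)

lemma diffAt_deriv {x : ℝ} (h : IsSDiffeo φ) (hx : x ∈ Ioo (0:ℝ) 1) :
    DifferentiableAt ℝ (deriv φ) x :=
  (h.diffAt_D hx).congr_of_eventuallyEq (h.eventually_D hx)

lemma deriv2_eq {x : ℝ} (h : IsSDiffeo φ) (hx : x ∈ Ioo (0:ℝ) 1) :
    deriv (deriv φ) x = derivWithin (derivWithin φ (Icc 0 1)) (Icc 0 1) x := by
  rw [(h.eventually_D hx).deriv_eq, (h.diffAt_D hx).derivWithin
    (uniqueDiffOn_Icc zero_lt_one x (Ioo_subset_Icc_self hx))]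

lemma bdd (h : IsSDiffeo φ) : BddAbove ((fun x => |nonlinearity φ x|) '' Icc 0 1) := by
  have hc2 : ContinuousOn (derivWithin (derivWithin φ (Icc 0 1)) (Icc 0 1)) (Icc 0 1) :=
    h.contDiff_D.continuousOn_derivWithin (uniqueDiffOn_Icc zero_lt_one) (by norm_num)
  have hq : ContinuousOn (fun x => |derivWithin (derivWithin φ (Icc 0 1)) (Icc 0 1) x
      / deriv φ x|) (Icc (0:ℝ) 1) :=
    (hc2.div h.contOn_deriv fun x hx => (h.derivPos x hx).ne').abs
  obtain ⟨M, hM⟩ := isCompact_Icc.bddAbove_image hq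
  refine ⟨max M (max |nonlinearity φ 0| |nonlinearity φ 1|), ?_⟩
  rintro _ ⟨x, hx, rfl⟩
  rcases eq_or_lt_of_le hx.1 with h0 | h0
  · subst h0
    exact le_max_of_le_right (le_max_left _ _)
  rcases eq_or_lt_of_le hx.2 with h1 | h1
  · subst h1
    exact le_max_of_le_right (le_max_right _ _)
  refine le_max_of_le_left ?_
  have := hM ⟨x, hx, rfl⟩
  simpa [nonlinearity, h.deriv2_eq ⟨h0, h1⟩] using this

lemma log_dist (h : IsSDiffeo φ) {δ : ℝ} (hδ : diffeoNorm φ < δ) {x y : ℝ}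
    (hx : x ∈ Icc (0:ℝ) 1) (hy : y ∈ Icc (0:ℝ) 1) (hxy : x < y) :
    |Real.log (deriv φ y) - Real.log (deriv φ x)| ≤ δ := by
  have hsub : Icc x y ⊆ Icc (0:ℝ) 1 := Icc_subset_Icc hx.1 hy.2
  have hsub' : Ioo x y ⊆ Ioo (0:ℝ) 1 := Ioo_subset_Ioo hx.1 hy.2
  obtain ⟨z, hz, hzs⟩ := exists_hasDerivAt_eq_slope (fun t => Real.log (deriv φ t))
    (nonlinearity φ) hxy
    ((h.contOn_deriv.mono hsub).log fun t ht => (h.derivPos t (hsub ht)).ne')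
    (fun t ht => (h.diffAt_deriv (hsub' ht)).hasDerivAt.log
      (h.derivPos t (Ioo_subset_Icc_self (hsub' ht))).ne')
  have hN : |nonlinearity φ z| ≤ diffeoNorm φ :=
    le_csSup h.bdd ⟨z, Ioo_subset_Icc_self (hsub' hz), rfl⟩
  have hpos : 0 < y - x := by linarith
  rw [eq_div_iff hpos.ne'] at hzs
  rw [← hzs, abs_mul, abs_of_pos hpos]
  have : y - x ≤ 1 := by linarith [hx.1, hy.2]
  nlinarith [abs_nonneg (nonlinearity φ z)]

lemma dist (h : IsSDiffeo φ) {δ : ℝ} (hδ : diffeoNorm φ < δ) {x y : ℝ}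
    (hx : x ∈ Icc (0:ℝ) 1) (hy : y ∈ Icc (0:ℝ) 1) :
    |Real.log (deriv φ y) - Real.log (deriv φ x)| ≤ δ := by
  rcases lt_trichotomy x y with hxy | hxy | hxy
  · exact h.log_dist hδ hx hy hxy
  · subst hxy
    have hN : |nonlinearity φ x| ≤ diffeoNorm φ := le_csSup h.bdd ⟨x, hx, rfl⟩
    simp only [sub_self, abs_zero]
    linarith [abs_nonneg (nonlinearity φ x)]
  · rw [abs_sub_comm]
    exact h.log_dist hδ hy hx hxy

lemma mvt (h : IsSDiffeo φ) {x y : ℝ}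
    (hx : x ∈ Icc (0:ℝ) 1) (hy : y ∈ Icc (0:ℝ) 1) (hxy : x < y) :
    ∃ z ∈ Icc (0:ℝ) 1, φ y - φ x = deriv φ z * (y - x) := by
  have hsub : Icc x y ⊆ Icc (0:ℝ) 1 := Icc_subset_Icc hx.1 hy.2
  obtain ⟨z, hz, hzs⟩ := exists_deriv_eq_slope φ hxy (h.contOn.mono hsub)
    (fun t ht => (h.diffAt (hsub (Ioo_subset_Icc_self ht))).differentiableWithinAt)
  refine ⟨z, hsub (Ioo_subset_Icc_self hz), ?_⟩
  rw [hzs, div_mul_cancel₀]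
  linarith

end IsSDiffeo

namespace LorenzMap

variable {α : ℝ}

lemma cont_qminus (hα : 1 < α) (u c : ℝ) : Continuous (qminus α u c) := by
  unfold qminus
  refine continuous_const.mul (continuous_const.sub ?_)
  exact Continuous.rpow_const (by fun_prop) fun x => Or.inr (by linarith)

lemma cont_qplus (hα : 1 < α) (u c : ℝ) : Continuous (qplus α u c) := by
  unfold qplus
  refine continuous_const.add (continuous_const.mul (continuous_const.add ?_))
  exact Continuous.rpow_const (by fun_prop) fun x => Or.inr (by linarith)

lemma qminus_c (hα : 1 < α) (u c : ℝ) : qminus α u c c = u := by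
  simp [qminus, Real.zero_rpow (by linarith : α ≠ 0)]

lemma qplus_c (hα : 1 < α) (u c : ℝ) : qplus α u c c = 1 - u := by
  simp [qplus, Real.zero_rpow (by linarith : α ≠ 0)]
  ring

lemma qminus_0 (u : ℝ) {c : ℝ} (hc : c ∈ Ioo (0:ℝ) 1) : qminus α u c 0 = 0 := by
  simp [qminus, div_self hc.1.ne']

lemma qplus_1 (u : ℝ) {c : ℝ} (hc : c ∈ Ioo (0:ℝ) 1) : qplus α u c 1 = 1 := by
  simp [qplus, div_self (by linarith [hc.2] : (1:ℝ) - c ≠ 0)]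

lemma qminus_mono (hα : 1 < α) {u c : ℝ} (hu : u ∈ Icc (0:ℝ) 1) (hc : c ∈ Ioo (0:ℝ) 1) :
    MonotoneOn (qminus α u c) (Icc 0 c) := by
  intro x hx y hy hxy
  unfold qminus
  have h1 : |(c - y) / c| ≤ |(c - x) / c| := by
    rw [abs_of_nonneg (div_nonneg (by linarith [hy.2]) hc.1.le),
      abs_of_nonneg (div_nonneg (by linarith [hx.2]) hc.1.le)]
    exact div_le_div_of_nonneg_right (by linarith) hc.1.le
  have h2 := Real.rpow_le_rpow (abs_nonneg _) h1 (by linarith : 0 ≤ α)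
  exact mul_le_mul_of_nonneg_left (by linarith) hu.1

lemma qplus_mono (hα : 1 < α) {u c : ℝ} (hu : u ∈ Icc (0:ℝ) 1) (hc : c ∈ Ioo (0:ℝ) 1) :
    MonotoneOn (qplus α u c) (Icc c 1) := by
  intro x hx y hy hxy
  unfold qplus
  have hc' : 0 < 1 - c := by linarith [hc.2]
  have h1 : |(x - c) / (1 - c)| ≤ |(y - c) / (1 - c)| := by
    rw [abs_of_nonneg (div_nonneg (by linarith [hx.1, hy.1]) hc'.le),
      abs_of_nonneg (div_nonneg (by linarith [hx.1, hy.1]) hc'.le)]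
    exact div_le_div_of_nonneg_right (by linarith) hc'.le
  have h2 := Real.rpow_le_rpow (abs_nonneg _) h1 (by linarith : 0 ≤ α)
  have := mul_le_mul_of_nonneg_left h2 hu.1
  linarith

lemma qminus_mem (hα : 1 < α) {u c : ℝ} (hu : u ∈ Icc (0:ℝ) 1) (hc : c ∈ Ioo (0:ℝ) 1)
    {x : ℝ} (hx : x ∈ Icc 0 c) : qminus α u c x ∈ Icc (0:ℝ) 1 := by
  have h0 := qminus_mono hα hu hc (left_mem_Icc.2 hc.1.le) hx hx.1
  have h1 := qminus_mono hα hu hc hx (right_mem_Icc.2 hc.1.le) hx.2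
  rw [qminus_0 u hc] at h0
  rw [qminus_c hα] at h1
  exact ⟨h0, h1.trans hu.2⟩

lemma qplus_mem (hα : 1 < α) {u c : ℝ} (hu : u ∈ Icc (0:ℝ) 1) (hc : c ∈ Ioo (0:ℝ) 1)
    {x : ℝ} (hx : x ∈ Icc c 1) : qplus α u c x ∈ Icc (0:ℝ) 1 := by
  have h0 := qplus_mono hα hu hc (left_mem_Icc.2 hc.2.le) hx hx.1
  have h1 := qplus_mono hα hu hc hx (right_mem_Icc.2 hc.2.le) hx.2
  rw [qplus_1 u hc] at h1
  rw [qplus_c hα] at h0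
  exact ⟨by linarith [hu.2], h1⟩

lemma qminus_diff {u c x : ℝ} (hc : c ∈ Ioo (0:ℝ) 1) (hx : x < c) :
    DifferentiableAt ℝ (qminus α u c) x := by
  unfold qminus
  have hne : (c - x) / c ≠ 0 := (div_pos (by linarith) hc.1).ne'
  have h1 : DifferentiableAt ℝ (fun x => |(c - x) / c|) x :=
    (differentiableAt_abs hne).comp (f := fun x => (c - x) / c) x (by fun_prop)
  have h2 := h1.rpow_const (p := α) (Or.inl (abs_ne_zero.2 hne))
  exact (h2.const_sub 1).const_mul u

lemma qplus_diff {u c x : ℝ} (hc : c ∈ Ioo (0:ℝ) 1) (hx : c < x) :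
    DifferentiableAt ℝ (qplus α u c) x := by
  unfold qplus
  have hne : (x - c) / (1 - c) ≠ 0 := (div_pos (by linarith) (by linarith [hc.2])).ne'
  have h1 : DifferentiableAt ℝ (fun x => |(x - c) / (1 - c)|) x :=
    (differentiableAt_abs hne).comp (f := fun x => (x - c) / (1 - c)) x (by fun_prop)
  have h2 := h1.rpow_const (p := α) (Or.inl (abs_ne_zero.2 hne))
  exact ((h2.const_add (-1)).const_mul u).const_add 1

variable (f : LorenzMap α)

lemma u_pos (hα : 1 < α) : 0 < f.u := by
  rcases eq_or_lt_of_le f.hu.1 with h | h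
  · have := f.hleft f.c ⟨f.hc.1, le_rfl⟩
    rw [qminus_c hα, ← h, f.hφ.fix0] at this
    linarith [f.hc.1]
  · exact h

lemma v_pos (hα : 1 < α) : 0 < f.v := by
  rcases eq_or_lt_of_le f.hv.1 with h | h
  · have := f.hright f.c ⟨le_rfl, f.hc.2⟩
    rw [qplus_c hα, ← h, sub_zero, f.hψ.fix1] at this
    linarith [f.hc.2]
  · exact h

lemma fm_0 : f.fm 0 = 0 := by
  simp [fm, qminus_0 f.u f.hc, f.hφ.fix0]

lemma fp_1 : f.fp 1 = 1 := by
  simp [fp, qplus_1 f.v f.hc, f.hψ.fix1]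

lemma fm_mono (hα : 1 < α) : MonotoneOn f.fm (Icc 0 f.c) := fun _ hx _ hy hxy =>
  f.hφ.strictMono.monotoneOn (qminus_mem hα f.hu f.hc hx) (qminus_mem hα f.hu f.hc hy)
    (qminus_mono hα f.hu f.hc hx hy hxy)

lemma fp_mono (hα : 1 < α) : MonotoneOn f.fp (Icc f.c 1) := fun _ hx _ hy hxy =>
  f.hψ.strictMono.monotoneOn (qplus_mem hα f.hv f.hc hx) (qplus_mem hα f.hv f.hc hy)
    (qplus_mono hα f.hv f.hc hx hy hxy)

lemma fm_mem (hα : 1 < α) {x : ℝ} (hx : x ∈ Icc 0 f.c) : f.fm x ∈ Icc (0:ℝ) 1 :=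
  f.hφ.mapsTo (qminus_mem hα f.hu f.hc hx)

lemma fp_mem (hα : 1 < α) {x : ℝ} (hx : x ∈ Icc f.c 1) : f.fp x ∈ Icc (0:ℝ) 1 :=
  f.hψ.mapsTo (qplus_mem hα f.hv f.hc hx)

lemma fm_cont (hα : 1 < α) {x : ℝ} (hx : x ∈ Icc 0 f.c) : ContinuousAt f.fm x :=
  (f.hφ.diffAt (qminus_mem hα f.hu f.hc hx)).continuousAt.comp
    (f := qminus α f.u f.c) (cont_qminus hα _ _).continuousAt

lemma fp_cont (hα : 1 < α) {x : ℝ} (hx : x ∈ Icc f.c 1) : ContinuousAt f.fp x :=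
  (f.hψ.diffAt (qplus_mem hα f.hv f.hc hx)).continuousAt.comp
    (f := qplus α f.v f.c) (cont_qplus hα _ _).continuousAt

lemma toFun_left {x : ℝ} (hx : x < f.c) : f.toFun x = f.fm x := by simp [toFun, hx]

lemma toFun_right {x : ℝ} (hx : f.c ≤ x) : f.toFun x = f.fp x := by
  simp [toFun, not_lt.2 hx]

lemma toFun_diff_left (hα : 1 < α) {x : ℝ} (hx : x ∈ Ico 0 f.c) :
    DifferentiableAt ℝ f.toFun x := by
  have h : DifferentiableAt ℝ f.fm x :=
    (f.hφ.diffAt (qminus_mem hα f.hu f.hc (Ico_subset_Icc_self hx))).comp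
      (f := qminus α f.u f.c) x (qminus_diff f.hc hx.2)
  refine h.congr_of_eventuallyEq ?_
  filter_upwards [Iio_mem_nhds hx.2] with y hy
  exact f.toFun_left hy

lemma toFun_diff_right (hα : 1 < α) {x : ℝ} (hx : x ∈ Ioc f.c 1) :
    DifferentiableAt ℝ f.toFun x := by
  have h : DifferentiableAt ℝ f.fp x :=
    (f.hψ.diffAt (qplus_mem hα f.hv f.hc (Ioc_subset_Icc_self hx))).comp
      (f := qplus α f.v f.c) x (qplus_diff f.hc hx.1)
  refine h.congr_of_eventuallyEq ?_
  filter_upwards [Ioi_mem_nhds hx.1] with y hy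
  exact f.toFun_right (le_of_lt hy)

/-- Orbits on the right of `c` dominate a lower orbit. -/
lemma orbit_right (hα : 1 < α) {p : ℝ} (n : ℕ) (hp1 : p ≤ 1)
    (hp : ∀ i < n, f.c < f.toFun^[i] p) {z : ℝ} (hz : z ∈ Icc p 1) :
    ∀ i ≤ n, f.toFun^[i] p ≤ f.toFun^[i] z ∧ f.toFun^[i] p ≤ 1 ∧ f.toFun^[i] z ≤ 1 ∧
      DifferentiableAt ℝ (f.toFun^[i]) z := by
  intro i
  induction i with
  | zero => exact fun _ => ⟨hz.1, hp1, hz.2, by simp⟩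
  | succ i ih =>
    intro hi
    obtain ⟨h1, h2, h3, h4⟩ := ih (by omega)
    have hc := hp i (by omega)
    have hzS : f.toFun^[i] z ∈ Ioc f.c 1 := ⟨hc.trans_le h1, h3⟩
    have hpS : f.toFun^[i] p ∈ Ioc f.c 1 := ⟨hc, h2⟩
    have e1 : f.toFun^[i+1] z = f.fp (f.toFun^[i] z) := by
      rw [iterate_succ_apply', f.toFun_right hzS.1.le]
    have e2 : f.toFun^[i+1] p = f.fp (f.toFun^[i] p) := by
      rw [iterate_succ_apply', f.toFun_right hpS.1.le]
    refine ⟨?_, ?_, ?_, ?_⟩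
    · rw [e1, e2]
      exact f.fp_mono hα (Ioc_subset_Icc_self hpS) (Ioc_subset_Icc_self hzS) h1
    · rw [e2]; exact (f.fp_mem hα (Ioc_subset_Icc_self hpS)).2
    · rw [e1]; exact (f.fp_mem hα (Ioc_subset_Icc_self hzS)).2
    · rw [iterate_succ']
      exact (f.toFun_diff_right hα hzS).comp z h4

/-- Orbits on the left of `c` are dominated by an upper orbit. -/
lemma orbit_left (hα : 1 < α) {p : ℝ} (n : ℕ) (hp1 : 0 ≤ p)
    (hp : ∀ i < n, f.toFun^[i] p < f.c) {z : ℝ} (hz : z ∈ Icc 0 p) :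
    ∀ i ≤ n, f.toFun^[i] z ≤ f.toFun^[i] p ∧ 0 ≤ f.toFun^[i] p ∧ 0 ≤ f.toFun^[i] z ∧
      DifferentiableAt ℝ (f.toFun^[i]) z := by
  intro i
  induction i with
  | zero => exact fun _ => ⟨hz.2, hp1, hz.1, by simp⟩
  | succ i ih =>
    intro hi
    obtain ⟨h1, h2, h3, h4⟩ := ih (by omega)
    have hc := hp i (by omega)
    have hzS : f.toFun^[i] z ∈ Ico 0 f.c := ⟨h3, h1.trans_lt hc⟩
    have hpS : f.toFun^[i] p ∈ Ico 0 f.c := ⟨h2, hc⟩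
    have e1 : f.toFun^[i+1] z = f.fm (f.toFun^[i] z) := by
      rw [iterate_succ_apply', f.toFun_left hzS.2]
    have e2 : f.toFun^[i+1] p = f.fm (f.toFun^[i] p) := by
      rw [iterate_succ_apply', f.toFun_left hpS.2]
    refine ⟨?_, ?_, ?_, ?_⟩
    · rw [e1, e2]
      exact f.fm_mono hα (Ico_subset_Icc_self hzS) (Ico_subset_Icc_self hpS) h1
    · rw [e2]; exact (f.fm_mem hα (Ico_subset_Icc_self hpS)).1
    · rw [e1]; exact (f.fm_mem hα (Ico_subset_Icc_self hzS)).1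
    · rw [iterate_succ']
      exact (f.toFun_diff_left hα hzS).comp z h4

/-- Distortion of the left branch near the critical point. -/
lemma fm_slope (hα : 1 < α) {l : ℝ} (hl0 : 0 ≤ l) (hlc : l < f.c) :
    ∃ s ∈ Icc (0:ℝ) 1, f.fm f.c - f.fm l = deriv f.φ s * (f.u * ((f.c - l) / f.c) ^ α) := by
  have hc := f.hc
  have e : f.u - qminus α f.u f.c l = f.u * ((f.c - l) / f.c) ^ α := by
    unfold qminus
    rw [abs_of_pos (div_pos (by linarith) hc.1)]; ring
  have hpos : 0 < f.u * ((f.c - l) / f.c) ^ α :=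
    mul_pos (f.u_pos hα) (Real.rpow_pos_of_pos (div_pos (by linarith) hc.1) _)
  obtain ⟨s, hs, h⟩ := f.hφ.mvt (qminus_mem hα f.hu hc ⟨hl0, hlc.le⟩) f.hu (by linarith)
  refine ⟨s, hs, ?_⟩
  rw [← e, ← h]
  simp [fm, qminus_c hα]

/-- Distortion of the right branch near the critical point. -/
lemma fp_slope (hα : 1 < α) {r : ℝ} (hr1 : r ≤ 1) (hcr : f.c < r) :
    ∃ s ∈ Icc (0:ℝ) 1,
      f.fp r - f.fp f.c = deriv f.ψ s * (f.v * ((r - f.c) / (1 - f.c)) ^ α) := by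
  have hc := f.hc
  have e : qplus α f.v f.c r - (1 - f.v) = f.v * ((r - f.c) / (1 - f.c)) ^ α := by
    unfold qplus
    rw [abs_of_pos (div_pos (by linarith) (by linarith [hc.2]))]; ring
  have hpos : 0 < f.v * ((r - f.c) / (1 - f.c)) ^ α :=
    mul_pos (f.v_pos hα)
      (Real.rpow_pos_of_pos (div_pos (by linarith) (by linarith [hc.2])) _)
  obtain ⟨s, hs, h⟩ := f.hψ.mvt (x := 1 - f.v) ⟨by linarith [f.hv.2], by linarith [f.hv.1]⟩
    (qplus_mem hα f.hv hc ⟨hcr.le, hr1⟩) (by linarith)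
  refine ⟨s, hs, ?_⟩
  rw [← e, ← h]
  simp [fp, qplus_c hα]

end LorenzMap

lemma firstReturn_spec {F : ℝ → ℝ} {C : Set ℝ} {x : ℝ} {n : ℕ} (hn : 0 < n)
    (hmem : F^[n] x ∈ C) (hnot : ∀ i, 1 ≤ i → i < n → F^[i] x ∉ C) :
    firstReturn F C x = n := by
  unfold firstReturn
  refine le_antisymm (Nat.sInf_le ⟨hn, hmem⟩) ?_
  have h := Nat.sInf_mem (s := {k : ℕ | 0 < k ∧ F^[k] x ∈ C}) ⟨n, hn, hmem⟩
  by_contra! hlt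
  exact hnot _ h.1 hlt h.2

lemma firstReturn_le_spec {F : ℝ → ℝ} {C : Set ℝ} {x : ℝ} {n : ℕ} (hn : 0 < n)
    (hmem : F^[n] x ∈ C) : 1 ≤ firstReturn F C x ∧ firstReturn F C x ≤ n := by
  unfold firstReturn
  exact ⟨(Nat.sInf_mem (s := {k : ℕ | 0 < k ∧ F^[k] x ∈ C}) ⟨n, hn, hmem⟩).1,
    Nat.sInf_le ⟨hn, hmem⟩⟩

/-- The critical value of the left branch of the renormalization. -/
lemma renorm_left {α : ℝ} (hα : 1 < α) (f g : LorenzMap α) (a : ℕ) (l r : ℝ)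
    (hpair : IsRenormPair f g l r)
    (h1 : ∀ i, 1 ≤ i → i ≤ a → ∀ x ∈ Ico l f.c, f.c < f.toFun^[i] x)
    (h2 : f.toFun^[a+1] '' Ico l f.c ⊆ Icc l r) :
    ∃ y ∈ f.toFun '' Ico l f.c,
      g.fm g.c = deriv (f.toFun^[a]) y * (f.fm f.c - f.fm l) / (r - l) := by
  obtain ⟨hl0, hlc, hcr, hr1, -, hgc, hconj⟩ := hpair
  have hc := f.hc
  have hrl : 0 < r - l := by linarith
  have hsubC : ∀ x ∈ Ico l f.c, x ∈ Icc 0 f.c := fun x hx => ⟨hl0.trans hx.1, hx.2.le⟩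
  have hcI : f.c ∈ Icc 0 f.c := ⟨hc.1.le, le_rfl⟩
  have hlI : l ∈ Icc 0 f.c := ⟨hl0, hlc.le⟩
  have hl : l ∈ Ico l f.c := ⟨le_rfl, hlc⟩
  have hp : ∀ i < a, f.c < f.toFun^[i] (f.fm l) := by
    intro i hi
    have := h1 (i+1) (by omega) (by omega) l hl
    rwa [iterate_succ_apply, f.toFun_left hlc] at this
  have horb := fun z (hz : z ∈ Icc (f.fm l) 1) =>
    f.orbit_right hα a (f.fm_mem hα hlI).2 hp hz
  have hg0 : g.toFun 0 = 0 := by rw [g.toFun_left g.hc.1, g.fm_0]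
  -- the return time is `a + 1`
  have hfr : ∀ x ∈ Ico l f.c, firstReturn f.toFun (Icc l r) x = a + 1 := by
    intro x hx
    refine firstReturn_spec (by omega) (h2 ⟨x, hx, rfl⟩) ?_
    intro i hi1 hi2 hmem
    have hli := h1 i hi1 (by omega) l hl
    have hfx : f.fm x ∈ Icc (f.fm l) 1 :=
      ⟨f.fm_mono hα hlI (hsubC x hx) hx.1, (f.fm_mem hα (hsubC x hx)).2⟩
    have hle : f.toFun^[i] l ≤ f.toFun^[i] x := by
      obtain ⟨j, rfl⟩ : ∃ j, i = j + 1 := ⟨i - 1, by omega⟩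
      rw [iterate_succ_apply, iterate_succ_apply, f.toFun_left hlc, f.toFun_left hx.2]
      exact (horb _ hfx j (by omega)).1
    have hlmem : f.toFun^[i] l ∈ Icc l r := ⟨by linarith, hle.trans hmem.2⟩
    obtain ⟨k1, k2⟩ := firstReturn_le_spec (by omega) hlmem
    have hk := h1 _ k1 (by omega) l hl
    have := (hconj l ⟨le_rfl, by linarith⟩ hlc.ne).2
    rw [this] at hk
    simp [hg0] at hk
    linarith
  have hval : ∀ x ∈ Ico l f.c,
      f.toFun^[a] (f.fm x) = l + (r - l) * g.fm ((x - l) / (r - l)) := by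
    intro x hx
    have := (hconj x ⟨hx.1, by linarith [hx.2]⟩ hx.2.ne).2
    rw [hfr x hx, iterate_succ_apply, f.toFun_left hx.2, g.toFun_left] at this
    · exact this
    · rw [hgc]
      exact div_lt_div_of_pos_right (by linarith [hx.2]) hrl
  have hvl : f.toFun^[a] (f.fm l) = l := by
    rw [hval l hl]; simp [g.fm_0]
  have hlt : f.fm l < f.fm f.c := by
    obtain ⟨s, hs, h⟩ := f.fm_slope hα hl0 hlc
    have : 0 < deriv f.φ s * (f.u * ((f.c - l) / f.c) ^ α) :=
      mul_pos (f.hφ.derivPos s hs) (mul_pos (f.u_pos hα)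
        (Real.rpow_pos_of_pos (div_pos (by linarith) hc.1) _))
    linarith
  have hfc1 : f.fm f.c ≤ 1 := (f.fm_mem hα hcI).2
  -- limit at the critical point
  have hvc : f.toFun^[a] (f.fm f.c) = l + (r - l) * g.fm g.c := by
    have t1 : Tendsto (fun x => f.toFun^[a] (f.fm x)) (𝓝[<] f.c)
        (𝓝 (f.toFun^[a] (f.fm f.c))) := by
      have : ContinuousAt (fun x => f.toFun^[a] (f.fm x)) f.c :=
        ContinuousAt.comp (g := f.toFun^[a]) (f := f.fm)
          (horb _ ⟨hlt.le, hfc1⟩ a le_rfl).2.2.2.continuousAt (f.fm_cont hα hcI)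
      exact this.tendsto.mono_left nhdsWithin_le_nhds
    have t2 : Tendsto (fun x => l + (r - l) * g.fm ((x - l) / (r - l))) (𝓝[<] f.c)
        (𝓝 (l + (r - l) * g.fm g.c)) := by
      have hgcont : ContinuousAt g.fm ((f.c - l) / (r - l)) := by
        rw [← hgc]; exact g.fm_cont hα ⟨g.hc.1.le, le_rfl⟩
      have : ContinuousAt (fun x => g.fm ((x - l) / (r - l))) f.c :=
        ContinuousAt.comp (g := g.fm) (f := fun x => (x - l) / (r - l)) hgcont (by fun_prop)
      have := (this.const_mul (r - l)).const_add l
      rw [hgc]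
      exact this.mono_left nhdsWithin_le_nhds
    refine tendsto_nhds_unique_of_eventuallyEq t1 t2 ?_
    filter_upwards [Ico_mem_nhdsLT hlc] with x hx
    exact hval x hx
  obtain ⟨y, hy, hys⟩ := exists_deriv_eq_slope (f.toFun^[a]) hlt
    (fun z hz => (horb z ⟨hz.1, hz.2.trans hfc1⟩ a le_rfl).2.2.2.continuousAt.continuousWithinAt)
    (fun z hz => (horb z ⟨hz.1.le, hz.2.le.trans hfc1⟩ a le_rfl).2.2.2.differentiableWithinAt)
  refine ⟨y, ?_, ?_⟩
  · have hco : ContinuousOn f.fm (Icc l f.c) := fun x hx =>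
      (f.fm_cont hα ⟨hl0.trans hx.1, hx.2⟩).continuousWithinAt
    obtain ⟨x, hx, hxy⟩ := intermediate_value_Ioo hlc.le hco hy
    exact ⟨x, ⟨hx.1.le, hx.2⟩, by rw [f.toFun_left hx.2, hxy]⟩
  · rw [hys, hvc, hvl, div_mul_cancel₀ _ (by linarith)]
    field_simp
    ring

/-- The critical value of the right branch of the renormalization. -/
lemma renorm_right {α : ℝ} (hα : 1 < α) (f g : LorenzMap α) (b : ℕ) (l r : ℝ)
    (hpair : IsRenormPair f g l r)
    (h1 : ∀ i, 1 ≤ i → i ≤ b → ∀ x ∈ Ioc f.c r, f.toFun^[i] x < f.c)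
    (h2 : f.toFun^[b+1] '' Ioc f.c r ⊆ Icc l r) :
    ∃ y ∈ f.toFun '' Ioc f.c r,
      1 - g.fp g.c = deriv (f.toFun^[b]) y * (f.fp r - f.fp f.c) / (r - l) := by
  obtain ⟨hl0, hlc, hcr, hr1, -, hgc, hconj⟩ := hpair
  have hc := f.hc
  have hrl : 0 < r - l := by linarith
  have hsubC : ∀ x ∈ Ioc f.c r, x ∈ Icc f.c 1 := fun x hx => ⟨hx.1.le, hx.2.trans hr1⟩
  have hcI : f.c ∈ Icc f.c 1 := ⟨le_rfl, hc.2.le⟩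
  have hrI : r ∈ Icc f.c 1 := ⟨hcr.le, hr1⟩
  have hr : r ∈ Ioc f.c r := ⟨hcr, le_rfl⟩
  have hp : ∀ i < b, f.toFun^[i] (f.fp r) < f.c := by
    intro i hi
    have := h1 (i+1) (by omega) (by omega) r hr
    rwa [iterate_succ_apply, f.toFun_right hcr.le] at this
  have horb := fun z (hz : z ∈ Icc 0 (f.fp r)) =>
    f.orbit_left hα b (f.fp_mem hα hrI).1 hp hz
  have hg1 : g.toFun 1 = 1 := by rw [g.toFun_right g.hc.2.le, g.fp_1]
  -- the return time is `b + 1`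
  have hfr : ∀ x ∈ Ioc f.c r, firstReturn f.toFun (Icc l r) x = b + 1 := by
    intro x hx
    refine firstReturn_spec (by omega) (h2 ⟨x, hx, rfl⟩) ?_
    intro i hi1 hi2 hmem
    have hri := h1 i hi1 (by omega) r hr
    have hfx : f.fp x ∈ Icc 0 (f.fp r) :=
      ⟨(f.fp_mem hα (hsubC x hx)).1, f.fp_mono hα (hsubC x hx) hrI hx.2⟩
    have hle : f.toFun^[i] x ≤ f.toFun^[i] r := by
      obtain ⟨j, rfl⟩ : ∃ j, i = j + 1 := ⟨i - 1, by omega⟩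
      rw [iterate_succ_apply, iterate_succ_apply, f.toFun_right hcr.le, f.toFun_right hx.1.le]
      exact (horb _ hfx j (by omega)).1
    have hrmem : f.toFun^[i] r ∈ Icc l r := ⟨hmem.1.trans hle, by linarith⟩
    obtain ⟨k1, k2⟩ := firstReturn_le_spec (by omega) hrmem
    have hk := h1 _ k1 (by omega) r hr
    have := (hconj r ⟨by linarith, le_rfl⟩ hcr.ne').2
    rw [this, div_self hrl.ne', hg1] at hk
    linarith
  have hval : ∀ x ∈ Ioc f.c r,
      f.toFun^[b] (f.fp x) = l + (r - l) * g.fp ((x - l) / (r - l)) := by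
    intro x hx
    have := (hconj x ⟨by linarith [hx.1], hx.2⟩ hx.1.ne').2
    rw [hfr x hx, iterate_succ_apply, f.toFun_right hx.1.le, g.toFun_right] at this
    · exact this
    · rw [hgc]
      exact div_le_div_of_nonneg_right (by linarith [hx.1]) hrl.le
  have hvr : f.toFun^[b] (f.fp r) = r := by
    rw [hval r hr, div_self hrl.ne', g.fp_1]; ring
  have hlt : f.fp f.c < f.fp r := by
    obtain ⟨s, hs, h⟩ := f.fp_slope hα hr1 hcr
    have : 0 < deriv f.ψ s * (f.v * ((r - f.c) / (1 - f.c)) ^ α) :=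
      mul_pos (f.hψ.derivPos s hs) (mul_pos (f.v_pos hα)
        (Real.rpow_pos_of_pos (div_pos (by linarith) (by linarith [hc.2])) _))
    linarith
  have hfc0 : 0 ≤ f.fp f.c := (f.fp_mem hα hcI).1
  -- limit at the critical point
  have hvc : f.toFun^[b] (f.fp f.c) = l + (r - l) * g.fp g.c := by
    have t1 : Tendsto (fun x => f.toFun^[b] (f.fp x)) (𝓝[>] f.c)
        (𝓝 (f.toFun^[b] (f.fp f.c))) := by
      have : ContinuousAt (fun x => f.toFun^[b] (f.fp x)) f.c :=
        ContinuousAt.comp (g := f.toFun^[b]) (f := f.fp)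
          (horb _ ⟨hfc0, hlt.le⟩ b le_rfl).2.2.2.continuousAt (f.fp_cont hα hcI)
      exact this.tendsto.mono_left nhdsWithin_le_nhds
    have t2 : Tendsto (fun x => l + (r - l) * g.fp ((x - l) / (r - l))) (𝓝[>] f.c)
        (𝓝 (l + (r - l) * g.fp g.c)) := by
      have hgcont : ContinuousAt g.fp ((f.c - l) / (r - l)) := by
        rw [← hgc]; exact g.fp_cont hα ⟨le_rfl, g.hc.2.le⟩
      have : ContinuousAt (fun x => g.fp ((x - l) / (r - l))) f.c :=
        ContinuousAt.comp (g := g.fp) (f := fun x => (x - l) / (r - l)) hgcont (by fun_prop)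
      have := (this.const_mul (r - l)).const_add l
      rw [hgc]
      exact this.mono_left nhdsWithin_le_nhds
    refine tendsto_nhds_unique_of_eventuallyEq t1 t2 ?_
    filter_upwards [Ioc_mem_nhdsGT hcr] with x hx
    exact hval x hx
  obtain ⟨y, hy, hys⟩ := exists_deriv_eq_slope (f.toFun^[b]) hlt
    (fun z hz => (horb z ⟨hfc0.trans hz.1, hz.2⟩ b le_rfl).2.2.2.continuousAt.continuousWithinAt)
    (fun z hz => (horb z ⟨hfc0.trans hz.1.le, hz.2.le⟩ b
      le_rfl).2.2.2.differentiableWithinAt)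
  refine ⟨y, ?_, ?_⟩
  · have hco : ContinuousOn f.fp (Icc f.c r) := fun x hx =>
      (f.fp_cont hα ⟨hx.1, hx.2.trans hr1⟩).continuousWithinAt
    obtain ⟨x, hx, hxy⟩ := intermediate_value_Ioo hcr.le hco hy
    exact ⟨x, ⟨hx.1, hx.2.le⟩, by rw [f.toFun_right hx.1.le, hxy]⟩
  · rw [hys, hvc, hvr, div_mul_cancel₀ _ (by linarith)]
    field_simp
    ring

/-- **Position of the critical point.** With `ρ(g) = c(g)/(1-c(g))` the relative
critical point and `ν(g) = g₋(c)/(1 - g₊(c))` the relative critical value: if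
`f ∈ L_δ` is `(a,b)`-renormalizable with renormalization `g = R f`, then
`ρ(Rf)^α/ν(Rf) = κ (ρ(f)^α/ν(f)) Df^b(x)/Df^a(y)` for some `x ∈ f(C₊)`,
`y ∈ f(C₋)` and `e^(-2δ) ≤ κ ≤ e^(2δ)`. -/
theorem position_of_critical_point (α : ℝ) (hα : 1 < α) (δ : ℝ)
    (f g : LorenzMap α) (a b : ℕ) (l r : ℝ)
    (hmem : f.memL δ) (hret : IsReturnInterval f l r) (hpair : IsRenormPair f g l r)
    (hab : ABCombinatorics f l r a b) :
    ∃ x ∈ f.toFun '' Set.Ioc f.c r, ∃ y ∈ f.toFun '' Set.Ico l f.c, ∃ κ : ℝ,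
      Real.exp (-(2 * δ)) ≤ κ ∧ κ ≤ Real.exp (2 * δ) ∧
      (g.c / (1 - g.c)) ^ α / (g.fm g.c / (1 - g.fp g.c)) =
        κ * ((f.c / (1 - f.c)) ^ α / (f.fm f.c / (1 - f.fp f.c))) *
          (deriv (f.toFun^[b]) x / deriv (f.toFun^[a]) y) := by
  obtain ⟨-, -, a1, -, -, a2, b1, -, -, b2⟩ := hab
  obtain ⟨y, hy, hyA⟩ := renorm_left hα f g a l r hpair a1 a2
  obtain ⟨x, hx, hxB⟩ := renorm_right hα f g b l r hpair b1 b2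
  obtain ⟨hl0, hlc, hcr, hr1, -, hgc, -⟩ := hpair
  have hc := f.hc
  have hrl : 0 < r - l := by linarith
  have h1c : 0 < 1 - f.c := by linarith [hc.2]
  have hcl : 0 < f.c - l := by linarith
  have hrc : 0 < r - f.c := by linarith
  have hu := f.u_pos hα
  have hv := f.v_pos hα
  obtain ⟨s, hs, hsE⟩ := f.fm_slope hα hl0 hlc
  obtain ⟨t, ht, htE⟩ := f.fp_slope hα hr1 hcr
  obtain ⟨s', hs', hsE'⟩ := f.fm_slope hα le_rfl hc.1
  obtain ⟨t', ht', htE'⟩ := f.fp_slope hα le_rfl hc.2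
  rw [f.fm_0, sub_zero, sub_zero, div_self hc.1.ne', Real.one_rpow, mul_one] at hsE'
  rw [f.fp_1, div_self h1c.ne', Real.one_rpow, mul_one] at htE'
  have ps := f.hφ.derivPos s hs
  have ps' := f.hφ.derivPos s' hs'
  have pt := f.hψ.derivPos t ht
  have pt' := f.hψ.derivPos t' ht'
  have dφ := abs_le.1 (f.hφ.dist hmem.1 hs hs')
  have dψ := abs_le.1 (f.hψ.dist hmem.2 ht' ht)
  have hκ : deriv f.φ s' / deriv f.φ s * (deriv f.ψ t / deriv f.ψ t') =
      Real.exp ((Real.log (deriv f.φ s') - Real.log (deriv f.φ s)) +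
        (Real.log (deriv f.ψ t) - Real.log (deriv f.ψ t'))) := by
    rw [Real.exp_add, Real.exp_sub, Real.exp_sub, Real.exp_log ps, Real.exp_log ps',
      Real.exp_log pt, Real.exp_log pt']
  refine ⟨x, hx, y, hy, deriv f.φ s' / deriv f.φ s * (deriv f.ψ t / deriv f.ψ t'), ?_, ?_, ?_⟩
  · rw [hκ]
    exact Real.exp_le_exp.2 (by linarith [dφ.1, dψ.1])
  · rw [hκ]
    exact Real.exp_le_exp.2 (by linarith [dφ.2, dψ.2])
  · have hρ : g.c / (1 - g.c) = (f.c - l) / (r - f.c) := by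
      rw [hgc]
      have : 1 - (f.c - l) / (r - l) = (r - f.c) / (r - l) := by field_simp; ring
      rw [this]
      field_simp
    rw [hρ, hyA, hxB, hsE, htE, hsE', htE', Real.div_rpow hcl.le hrc.le,
      Real.div_rpow hcl.le hc.1.le, Real.div_rpow hrc.le h1c.le, Real.div_rpow hc.1.le h1c.le]
    have p1 := Real.rpow_pos_of_pos hcl α
    have p2 := Real.rpow_pos_of_pos hrc α
    have p3 := Real.rpow_pos_of_pos hc.1 α
    have p4 := Real.rpow_pos_of_pos h1c α
    generalize (f.c - l) ^ α = P1 at *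
    generalize (r - f.c) ^ α = P2 at *
    generalize f.c ^ α = P3 at *
    generalize (1 - f.c) ^ α = P4 at *
    generalize deriv (f.toFun^[b]) x = X at *
    generalize deriv (f.toFun^[a]) y = Y at *
    by_cases hY : Y = 0
    · simp [hY]
    by_cases hX : X = 0
    · simp [hX]
    field_simp
end
end

section
/- (Derivatives of returns for small critical point) Let α_a = α^{−a}. For every δ < ∞ there exist K < ∞ and γ > 0 such that: if f ∈ L_δ is an (a,b)-renormalizable Lorenz map with b > α + 1 and critical point c < γ, then Df_-^b(x) ≥ K^{−b}·c^{−b(1−α_a)} for every x ∈ f_-^{−b}(C), and Df_+^a(y) ≤ K^a·c^{1−α_a} for every y ∈ f_+^{−a}(C), where Df_-^b and Df_+^a denote derivatives of iterates of the respective branches and f_-^{−b}(C), f_+^{−a}(C) denote preimages of the return interval C under iterates of the branches. -/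
open Set Filter Topology MeasureTheory Function

noncomputable section

/-- Uniform bounds on the derivative of a diffeomorphism. -/
def Bil (D : ℝ) (φ : ℝ → ℝ) : Prop :=
  φ 0 = 0 ∧ φ 1 = 1 ∧
  ∀ x ∈ Icc (0:ℝ) 1, DifferentiableAt ℝ φ x ∧ D⁻¹ ≤ deriv φ x ∧ deriv φ x ≤ D

lemma sdiffeo_bil {φ : ℝ → ℝ} {δ : ℝ} (h : IsSDiffeo φ) (hn : diffeoNorm φ < δ) :
    Bil (Real.exp |δ|) φ := by
  have hu := uniqueDiffOn_Icc (zero_lt_one (α := ℝ))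
  have hdiff : ∀ x ∈ Icc (0:ℝ) 1, DifferentiableAt ℝ φ x := fun x hx =>
    differentiableAt_of_deriv_ne_zero (h.derivPos x hx).ne'
  have hdw : ∀ x ∈ Icc (0:ℝ) 1, derivWithin φ (Icc 0 1) x = deriv φ x := fun x hx =>
    (hdiff x hx).derivWithin (hu x hx)
  have hg : ContDiffOn ℝ 2 (derivWithin φ (Icc 0 1)) (Icc 0 1) :=
    h.contDiff.derivWithin hu (by norm_num)
  have hgc : ContinuousOn (deriv φ) (Icc 0 1) :=
    hg.continuousOn.congr fun x hx => (hdw x hx).symm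
  have hg'c : ContinuousOn (derivWithin (derivWithin φ (Icc 0 1)) (Icc 0 1)) (Icc 0 1) :=
    hg.continuousOn_derivWithin hu (by norm_num)
  have hnhds : ∀ x ∈ Ioo (0:ℝ) 1, Icc (0:ℝ) 1 ∈ 𝓝 x := fun x hx => Icc_mem_nhds hx.1 hx.2
  have hev : ∀ x ∈ Ioo (0:ℝ) 1, derivWithin φ (Icc 0 1) =ᶠ[𝓝 x] deriv φ := fun x hx => by
    filter_upwards [hnhds x hx] with y hy using hdw y hy
  have hdd : ∀ x ∈ Ioo (0:ℝ) 1, DifferentiableAt ℝ (deriv φ) x := fun x hx => by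
    have := (hg.differentiableOn (by norm_num)).differentiableAt (hnhds x hx)
    exact this.congr_of_eventuallyEq (hev x hx).symm
  have hN : ∀ x ∈ Ioo (0:ℝ) 1, nonlinearity φ x =
      derivWithin (derivWithin φ (Icc 0 1)) (Icc 0 1) x / deriv φ x := fun x hx => by
    unfold nonlinearity
    rw [derivWithin_of_mem_nhds (hnhds x hx), (hev x hx).deriv_eq]
  have hbdd : BddAbove ((fun x => |nonlinearity φ x|) '' Icc 0 1) := by
    have hc : ContinuousOn (fun x => |derivWithin (derivWithin φ (Icc 0 1)) (Icc 0 1) x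
        / deriv φ x|) (Icc 0 1) :=
      (hg'c.div hgc fun x hx => (h.derivPos x hx).ne').abs
    obtain ⟨B, hB⟩ := (isCompact_Icc.image_of_continuousOn hc).bddAbove
    refine ⟨max B (max |nonlinearity φ 0| |nonlinearity φ 1|), ?_⟩
    rintro _ ⟨x, hx, rfl⟩
    rcases eq_or_lt_of_le hx.1 with h0 | h0
    · subst h0; simp
    rcases eq_or_lt_of_le hx.2 with h1 | h1
    · subst h1; simp
    · refine le_max_of_le_left ?_
      simp only [hN x ⟨h0, h1⟩]
      exact hB ⟨x, hx, rfl⟩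
  have hNle : ∀ x ∈ Icc (0:ℝ) 1, |nonlinearity φ x| ≤ |δ| := fun x hx =>
    ((le_csSup hbdd ⟨x, hx, rfl⟩).trans hn.le).trans (le_abs_self _)
  have hlogd : ∀ x ∈ Ioo (0:ℝ) 1, HasDerivAt (fun x => Real.log (deriv φ x))
      (nonlinearity φ x) x := fun x hx =>
    (hdd x hx).hasDerivAt.log (h.derivPos x (Ioo_subset_Icc_self hx)).ne'
  have hlogc : ContinuousOn (fun x => Real.log (deriv φ x)) (Icc 0 1) :=
    hgc.log fun x hx => (h.derivPos x hx).ne'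
  have key : ∀ x ∈ Icc (0:ℝ) 1, ∀ y ∈ Icc (0:ℝ) 1, x < y →
      |Real.log (deriv φ y) - Real.log (deriv φ x)| ≤ |δ| := by
    intro x hx y hy hxy
    obtain ⟨z, hz, hz'⟩ := exists_hasDerivAt_eq_slope (fun x => Real.log (deriv φ x))
      (nonlinearity φ) hxy (hlogc.mono (Icc_subset_Icc hx.1 hy.2))
      (fun w hw => hlogd w ⟨hx.1.trans_lt hw.1, hw.2.trans_le hy.2⟩)
    have hyx : 0 < y - x := sub_pos.2 hxy
    rw [eq_div_iff hyx.ne'] at hz'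
    rw [← hz', abs_mul, abs_of_pos hyx]
    have h1 := hNle z ⟨hx.1.trans hz.1.le, hz.2.le.trans hy.2⟩
    have h2 : y - x ≤ 1 := by linarith [hx.1, hy.2]
    nlinarith [abs_nonneg (nonlinearity φ z), abs_nonneg δ]
  obtain ⟨ξ, hξ, hξ'⟩ := exists_deriv_eq_slope φ zero_lt_one h.contDiff.continuousOn
    (fun x hx => (hdiff x (Ioo_subset_Icc_self hx)).differentiableWithinAt)
  have hξ1 : deriv φ ξ = 1 := by rw [hξ', h.fix0, h.fix1]; norm_num
  have hlog : ∀ x ∈ Icc (0:ℝ) 1, |Real.log (deriv φ x)| ≤ |δ| := by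
    intro x hx
    rcases lt_trichotomy x ξ with hlt | heq | hgt
    · have := key x hx ξ (Ioo_subset_Icc_self hξ) hlt
      rwa [hξ1, Real.log_one, zero_sub, abs_neg] at this
    · rw [heq, hξ1, Real.log_one]; simp
    · have := key ξ (Ioo_subset_Icc_self hξ) x hx hgt
      rwa [hξ1, Real.log_one, sub_zero] at this
  refine ⟨h.fix0, h.fix1, fun x hx => ⟨hdiff x hx, ?_, ?_⟩⟩
  · rw [← Real.exp_neg, ← Real.le_log_iff_exp_le (h.derivPos x hx)]
    linarith [(abs_le.1 (hlog x hx)).1]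
  · rw [← Real.log_le_iff_le_exp (h.derivPos x hx)]
    exact (abs_le.1 (hlog x hx)).2

lemma Bil.lip {D : ℝ} {φ : ℝ → ℝ} (h : Bil D φ) {x y : ℝ} (hx : 0 ≤ x) (hxy : x ≤ y)
    (hy : y ≤ 1) : D⁻¹ * (y - x) ≤ φ y - φ x ∧ φ y - φ x ≤ D * (y - x) := by
  have hs : Icc x y ⊆ Icc 0 1 := Icc_subset_Icc hx hy
  have hc : ContinuousOn φ (Icc x y) := fun z hz =>
    (h.2.2 z (hs hz)).1.continuousAt.continuousWithinAt
  have hd : DifferentiableOn ℝ φ (interior (Icc x y)) := fun z hz =>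
    (h.2.2 z (hs (interior_subset hz))).1.differentiableWithinAt
  constructor
  · exact (convex_Icc x y).mul_sub_le_image_sub_of_le_deriv hc hd
      (fun z hz => (h.2.2 z (hs (interior_subset hz))).2.1) x (left_mem_Icc.2 hxy) y
      (right_mem_Icc.2 hxy) hxy
  · exact (convex_Icc x y).image_sub_le_mul_sub_of_deriv_le hc hd
      (fun z hz => (h.2.2 z (hs (interior_subset hz))).2.2) x (left_mem_Icc.2 hxy) y
      (right_mem_Icc.2 hxy) hxy

section branches

variable {α : ℝ} (f : LorenzMap α) {D : ℝ}

lemma hm_mem {x : ℝ} (hx : x ∈ Icc 0 f.c) : (f.c - x) / f.c ∈ Icc (0:ℝ) 1 := by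
  have hc := f.hc.1
  constructor
  · exact div_nonneg (by linarith [hx.2]) hc.le
  · rw [div_le_one hc]; linarith [hx.1]

lemma tp_mem {x : ℝ} (hx : x ∈ Icc f.c 1) : (x - f.c) / (1 - f.c) ∈ Icc (0:ℝ) 1 := by
  have hc := f.hc.2
  constructor
  · exact div_nonneg (by linarith [hx.1]) (by linarith)
  · rw [div_le_one (by linarith)]; linarith [hx.2]

lemma qminus_eq {x : ℝ} (hx : x ∈ Icc 0 f.c) :
    qminus α f.u f.c x = f.u * (1 - ((f.c - x) / f.c) ^ α) := by
  unfold qminus; rw [abs_of_nonneg (hm_mem f hx).1]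

lemma qplus_eq {x : ℝ} (hx : x ∈ Icc f.c 1) :
    qplus α f.v f.c x = 1 + f.v * (-1 + ((x - f.c) / (1 - f.c)) ^ α) := by
  unfold qplus; rw [abs_of_nonneg (tp_mem f hx).1]

lemma qminus_mem (hα : 1 < α) {x : ℝ} (hx : x ∈ Icc 0 f.c) :
    qminus α f.u f.c x ∈ Icc (0:ℝ) 1 := by
  rw [qminus_eq f hx]
  have h := hm_mem f hx
  have h1 : 0 ≤ ((f.c - x) / f.c) ^ α := Real.rpow_nonneg h.1 _
  have h2 : ((f.c - x) / f.c) ^ α ≤ 1 := Real.rpow_le_one h.1 h.2 (by linarith)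
  have hu := f.hu
  constructor
  · exact mul_nonneg hu.1 (by linarith)
  · nlinarith [hu.1, hu.2]

lemma qplus_mem (hα : 1 < α) {x : ℝ} (hx : x ∈ Icc f.c 1) :
    qplus α f.v f.c x ∈ Icc (((x - f.c) / (1 - f.c)) ^ α) 1 := by
  rw [qplus_eq f hx]
  have h := tp_mem f hx
  have h1 : 0 ≤ ((x - f.c) / (1 - f.c)) ^ α := Real.rpow_nonneg h.1 _
  have h2 : ((x - f.c) / (1 - f.c)) ^ α ≤ 1 := Real.rpow_le_one h.1 h.2 (by linarith)
  have hv := f.hv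
  constructor
  · nlinarith [hv.1, hv.2]
  · nlinarith [hv.1, hv.2]

lemma fm_diff (hα : 1 < α) (hφ : Bil D f.φ) {x y : ℝ} (hx : x ∈ Icc 0 f.c)
    (hy : y ∈ Icc 0 f.c) (hxy : x ≤ y) :
    D⁻¹ * (f.u * (((f.c - x) / f.c) ^ α - ((f.c - y) / f.c) ^ α)) ≤ f.fm y - f.fm x ∧
    f.fm y - f.fm x ≤ D * (f.u * (((f.c - x) / f.c) ^ α - ((f.c - y) / f.c) ^ α)) := by
  have hle : ((f.c - y) / f.c) ^ α ≤ ((f.c - x) / f.c) ^ α :=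
    Real.rpow_le_rpow (hm_mem f hy).1
      (div_le_div_of_nonneg_right (by linarith) f.hc.1.le) (by linarith)
  have hq : qminus α f.u f.c y - qminus α f.u f.c x =
      f.u * (((f.c - x) / f.c) ^ α - ((f.c - y) / f.c) ^ α) := by
    rw [qminus_eq f hx, qminus_eq f hy]; ring
  have := hφ.lip (qminus_mem f hα hx).1 (y := qminus α f.u f.c y)
    (by
      have := mul_nonneg f.hu.1 (sub_nonneg.2 hle)
      linarith) (qminus_mem f hα hy).2
  rw [hq] at this
  exact this

lemma fp_diff (hα : 1 < α) (hψ : Bil D f.ψ) {x y : ℝ} (hx : x ∈ Icc f.c 1)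
    (hy : y ∈ Icc f.c 1) (hxy : x ≤ y) :
    D⁻¹ * (f.v * (((y - f.c) / (1 - f.c)) ^ α - ((x - f.c) / (1 - f.c)) ^ α))
      ≤ f.fp y - f.fp x ∧
    f.fp y - f.fp x
      ≤ D * (f.v * (((y - f.c) / (1 - f.c)) ^ α - ((x - f.c) / (1 - f.c)) ^ α)) := by
  have hle : ((x - f.c) / (1 - f.c)) ^ α ≤ ((y - f.c) / (1 - f.c)) ^ α :=
    Real.rpow_le_rpow (tp_mem f hx).1
      (div_le_div_of_nonneg_right (by linarith) (by linarith [f.hc.2])) (by linarith)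
  have hq : qplus α f.v f.c y - qplus α f.v f.c x =
      f.v * (((y - f.c) / (1 - f.c)) ^ α - ((x - f.c) / (1 - f.c)) ^ α) := by
    rw [qplus_eq f hx, qplus_eq f hy]; ring
  have := hψ.lip (x := qplus α f.v f.c x)
    ((Real.rpow_nonneg (tp_mem f hx).1 _).trans (qplus_mem f hα hx).1)
    (y := qplus α f.v f.c y)
    (by
      have := mul_nonneg f.hv.1 (sub_nonneg.2 hle)
      linarith) (qplus_mem f hα hy).2
  rw [hq] at this
  exact this

lemma fm_mono (hα : 1 < α) (hD : 1 ≤ D) (hφ : Bil D f.φ) {x y : ℝ} (hx : x ∈ Icc 0 f.c)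
    (hy : y ∈ Icc 0 f.c) (hxy : x ≤ y) : f.fm x ≤ f.fm y := by
  have h1 := (fm_diff f hα hφ hx hy hxy).1
  have hle : ((f.c - y) / f.c) ^ α ≤ ((f.c - x) / f.c) ^ α :=
    Real.rpow_le_rpow (hm_mem f hy).1
      (div_le_div_of_nonneg_right (by linarith) f.hc.1.le) (by linarith)
  have h2 : 0 ≤ D⁻¹ * (f.u * (((f.c - x) / f.c) ^ α - ((f.c - y) / f.c) ^ α)) :=
    mul_nonneg (by positivity) (mul_nonneg f.hu.1 (sub_nonneg.2 hle))
  linarith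

lemma fp_mono (hα : 1 < α) (hD : 1 ≤ D) (hψ : Bil D f.ψ) {x y : ℝ} (hx : x ∈ Icc f.c 1)
    (hy : y ∈ Icc f.c 1) (hxy : x ≤ y) : f.fp x ≤ f.fp y := by
  have h1 := (fp_diff f hα hψ hx hy hxy).1
  have hle : ((x - f.c) / (1 - f.c)) ^ α ≤ ((y - f.c) / (1 - f.c)) ^ α :=
    Real.rpow_le_rpow (tp_mem f hx).1
      (div_le_div_of_nonneg_right (by linarith) (by linarith [f.hc.2])) (by linarith)
  have h2 := mul_nonneg (by positivity : 0 ≤ D⁻¹) (mul_nonneg f.hv.1 (sub_nonneg.2 hle))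
  linarith

lemma fm_zero (hα : 1 < α) (hφ : Bil D f.φ) : f.fm 0 = 0 := by
  have hc := f.hc.1
  unfold LorenzMap.fm
  rw [qminus_eq f ⟨le_rfl, hc.le⟩, sub_zero, div_self hc.ne', Real.one_rpow, sub_self, mul_zero,
    hφ.1]

/-- Lower bound through the distance to the critical point. -/
lemma fm_lower' (hα : 1 < α) (hφ : Bil D f.φ) {x : ℝ} (hx : x ∈ Icc 0 f.c) :
    D⁻¹ * (f.u * (1 - ((f.c - x) / f.c) ^ α)) ≤ f.fm x := by
  have hc := f.hc.1
  have := (fm_diff f hα hφ ⟨le_rfl, hc.le⟩ hx hx.1).1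
  rwa [fm_zero f hα hφ, sub_zero, sub_zero, div_self hc.ne', Real.one_rpow] at this

lemma fm_lower (hα : 1 < α) (hD : 1 ≤ D) (hφ : Bil D f.φ) {x : ℝ} (hx : x ∈ Icc 0 f.c) :
    D⁻¹ * f.u / f.c * x ≤ f.fm x := by
  have hc := f.hc.1
  refine le_trans ?_ (fm_lower' f hα hφ hx)
  have h := hm_mem f hx
  have h1 : ((f.c - x) / f.c) ^ α ≤ (f.c - x) / f.c := by
    have := Real.rpow_le_rpow_of_exponent_ge' h.1 h.2 zero_le_one hα.le
    rwa [Real.rpow_one] at this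
  have h2 : x / f.c = 1 - (f.c - x) / f.c := by field_simp; ring
  have h3 : D⁻¹ * f.u / f.c * x = D⁻¹ * (f.u * (x / f.c)) := by ring
  rw [h3, h2]
  have := f.hu.1
  gcongr

lemma fm_c_le (hα : 1 < α) (hφ : Bil D f.φ) : f.fm f.c ≤ D * f.u := by
  have hc := f.hc.1
  have := (fm_diff f hα hφ ⟨le_rfl, hc.le⟩ ⟨hc.le, le_rfl⟩ hc.le).2
  rw [fm_zero f hα hφ, sub_zero, sub_zero, div_self hc.ne', Real.one_rpow, sub_self, zero_div,
    Real.zero_rpow (by linarith)] at this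
  linarith

lemma fm_c_sub (hα : 1 < α) (hφ : Bil D f.φ) {x : ℝ} (hx : x ∈ Icc 0 f.c) :
    f.fm f.c - f.fm x ≤ D * (f.u * ((f.c - x) / f.c) ^ α) := by
  have hc := f.hc.1
  have := (fm_diff f hα hφ hx ⟨hc.le, le_rfl⟩ hx.2).2
  rw [sub_self, zero_div, Real.zero_rpow (by linarith)] at this
  linarith

lemma fm_le_one (hα : 1 < α) (hD : 1 ≤ D) (hφ : Bil D f.φ) {x : ℝ} (hx : x ∈ Icc 0 f.c) :
    f.fm x ≤ 1 := by
  have h := qminus_mem f hα hx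
  have h1 := (hφ.lip h.1 h.2 le_rfl).1
  rw [hφ.2.1] at h1
  have : 0 ≤ D⁻¹ * (1 - qminus α f.u f.c x) := mul_nonneg (by positivity) (by linarith [h.2])
  unfold LorenzMap.fm
  linarith

lemma fp_c_sub (hα : 1 < α) (hD : 1 ≤ D) (hψ : Bil D f.ψ) {y : ℝ} (hy : y ∈ Icc f.c 1) :
    f.fp y - f.fp f.c ≤ D * ((y - f.c) / (1 - f.c)) ^ α := by
  have hc := f.hc
  have := (fp_diff f hα hψ ⟨le_rfl, hc.2.le⟩ hy hy.1).2
  rw [sub_self, zero_div, Real.zero_rpow (by linarith), sub_zero] at this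
  refine this.trans ?_
  have h1 : 0 ≤ ((y - f.c) / (1 - f.c)) ^ α := Real.rpow_nonneg (tp_mem f hy).1 _
  have := mul_le_of_le_one_left h1 f.hv.2
  gcongr

lemma fp_lower (hα : 1 < α) (hD : 1 ≤ D) (hψ : Bil D f.ψ) {y : ℝ} (hy : y ∈ Icc f.c 1) :
    D⁻¹ * ((y - f.c) / (1 - f.c)) ^ α ≤ f.fp y := by
  have h := qplus_mem f hα hy
  have h1 : 0 ≤ ((y - f.c) / (1 - f.c)) ^ α := Real.rpow_nonneg (tp_mem f hy).1 _
  have h2 := (hψ.lip le_rfl (h1.trans h.1) h.2).1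
  rw [hψ.1, sub_zero, sub_zero] at h2
  refine le_trans ?_ h2
  have := h.1
  gcongr

lemma fm_deriv (hα : 1 < α) (hD : 1 ≤ D) (hφ : Bil D f.φ) {x : ℝ} (hx : x ∈ Ico 0 f.c) :
    DifferentiableAt ℝ f.fm x ∧
    D⁻¹ * (f.u * (((f.c - x) / f.c) ^ (α - 1) / f.c)) ≤ deriv f.fm x := by
  have hc := f.hc.1
  have hx' : x ∈ Icc 0 f.c := ⟨hx.1, hx.2.le⟩
  have hq := qminus_mem f hα hx'
  have hpos : 0 < (f.c - x) / f.c := div_pos (by linarith [hx.2]) hc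
  have d1 : HasDerivAt (fun x => (f.c - x) / f.c) (-1 / f.c) x :=
    ((hasDerivAt_id x).const_sub f.c).div_const f.c
  have d2 := (hasDerivAt_abs_rpow ((f.c - x) / f.c) hα).comp x d1
  have d3 := (d2.const_sub 1).const_mul f.u
  have d4 := (hφ.2.2 _ hq).1.hasDerivAt
  have d5 : HasDerivAt f.fm _ x := HasDerivAt.comp x d4 d3
  refine ⟨d5.differentiableAt, ?_⟩
  rw [d5.deriv, abs_of_pos hpos]
  have e : ((f.c - x) / f.c) ^ (α - 1) = ((f.c - x) / f.c) ^ (α - 2) * ((f.c - x) / f.c) := by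
    rw [← Real.rpow_add_one hpos.ne']; congr 1; ring
  have hnn : 0 ≤ f.u * (((f.c - x) / f.c) ^ (α - 1) / f.c) :=
    mul_nonneg f.hu.1 (div_nonneg (Real.rpow_nonneg hpos.le _) hc.le)
  have e2 : f.u * -(α * ((f.c - x) / f.c) ^ (α - 2) * ((f.c - x) / f.c) * (-1 / f.c)) =
      α * (f.u * (((f.c - x) / f.c) ^ (α - 1) / f.c)) := by rw [e]; ring
  rw [e2]
  have h1 := (hφ.2.2 _ hq).2.1
  have h2 : f.u * (((f.c - x) / f.c) ^ (α - 1) / f.c) ≤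
    α * (f.u * (((f.c - x) / f.c) ^ (α - 1) / f.c)) := le_mul_of_one_le_left hnn hα.le
  have h3 : 0 < D⁻¹ := by positivity
  exact mul_le_mul h1 h2 hnn (h3.le.trans h1)

lemma fp_deriv (hα : 1 < α) (hD : 1 ≤ D) (hψ : Bil D f.ψ) {y : ℝ} (hy : y ∈ Icc f.c 1) :
    DifferentiableAt ℝ f.fp y ∧ 0 ≤ deriv f.fp y ∧
    deriv f.fp y ≤ D * (α * ((y - f.c) / (1 - f.c)) ^ (α - 1) / (1 - f.c)) := by
  have hc := f.hc.2
  have hq' := qplus_mem f hα hy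
  have ht := tp_mem f hy
  have hq : qplus α f.v f.c y ∈ Icc (0:ℝ) 1 := ⟨(Real.rpow_nonneg ht.1 _).trans hq'.1, hq'.2⟩
  have d1 : HasDerivAt (fun x => (x - f.c) / (1 - f.c)) (1 / (1 - f.c)) y :=
    ((hasDerivAt_id y).sub_const f.c).div_const (1 - f.c)
  have d2 := (hasDerivAt_abs_rpow ((y - f.c) / (1 - f.c)) hα).comp y d1
  have d3 := ((d2.const_add (-1)).const_mul f.v).const_add 1
  have d4 := (hψ.2.2 _ hq).1.hasDerivAt
  have d5 : HasDerivAt f.fp _ y := HasDerivAt.comp y d4 d3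
  have e : ((y - f.c) / (1 - f.c)) ^ (α - 1) =
      |(y - f.c) / (1 - f.c)| ^ (α - 2) * ((y - f.c) / (1 - f.c)) := by
    rw [abs_of_nonneg ht.1]
    rcases eq_or_lt_of_le ht.1 with h0 | h0
    · rw [← h0, mul_zero, Real.zero_rpow (by linarith)]
    · rw [← Real.rpow_add_one h0.ne']; congr 1; ring
  have hnn : 0 ≤ α * ((y - f.c) / (1 - f.c)) ^ (α - 1) / (1 - f.c) :=
    div_nonneg (mul_nonneg (by linarith) (Real.rpow_nonneg ht.1 _)) (by linarith)
  have e2 : f.v * (α * |(y - f.c) / (1 - f.c)| ^ (α - 2) * ((y - f.c) / (1 - f.c)) *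
      (1 / (1 - f.c))) = f.v * (α * ((y - f.c) / (1 - f.c)) ^ (α - 1) / (1 - f.c)) := by
    rw [e]; ring
  rw [e2] at d5
  have h1 := (hψ.2.2 _ hq).2
  have h3 : 0 < D⁻¹ := by positivity
  refine ⟨d5.differentiableAt, ?_, ?_⟩
  · rw [d5.deriv]
    exact mul_nonneg (h3.le.trans h1.1) (mul_nonneg f.hv.1 hnn)
  · rw [d5.deriv]
    exact mul_le_mul h1.2 (mul_le_of_le_one_left hnn f.hv.2) (mul_nonneg f.hv.1 hnn)
      (by linarith)

end branches

section steps

variable {α : ℝ} (f : LorenzMap α) {D : ℝ}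

lemma toFun_iter_fp (w : ℝ) (k : ℕ) (h : ∀ j < k, f.c ≤ f.toFun^[j] w) :
    f.toFun^[k] w = f.fp^[k] w := by
  induction k with
  | zero => rfl
  | succ k ih =>
    rw [iterate_succ_apply', iterate_succ_apply', ← ih fun j hj => h j (by omega)]
    unfold LorenzMap.toFun
    rw [if_neg]
    exact not_lt.2 (h k (by omega))

lemma toFun_iter_fm (w : ℝ) (k : ℕ) (h : ∀ j < k, f.toFun^[j] w < f.c) :
    f.toFun^[k] w = f.fm^[k] w := by
  induction k with
  | zero => rfl
  | succ k ih =>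
    rw [iterate_succ_apply', iterate_succ_apply', ← ih fun j hj => h j (by omega)]
    unfold LorenzMap.toFun
    rw [if_pos]
    exact h k (by omega)

lemma fp_le_self (hψ : Bil D f.ψ) {y : ℝ} (hy : y ∈ Icc f.c 1) : f.fp y ≤ y := by
  rcases eq_or_lt_of_le hy.2 with h1 | h1
  · have hc := f.hc.2
    rw [h1]
    unfold LorenzMap.fp
    rw [qplus_eq f ⟨hc.le, le_rfl⟩, div_self (by linarith), Real.one_rpow]
    norm_num [hψ.2.1]
  · exact (f.hright y ⟨hy.1, h1⟩).le

lemma fp_iter_le (hψ : Bil D f.ψ) {w : ℝ} (hw : w ≤ 1) (k : ℕ)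
    (h : ∀ j < k, f.c ≤ f.fp^[j] w) : f.fp^[k] w ≤ w := by
  induction k with
  | zero => exact le_rfl
  | succ k ih =>
    have h1 := ih fun j hj => h j (by omega)
    rw [iterate_succ_apply']
    exact (fp_le_self f hψ ⟨h k (by omega), h1.trans hw⟩).trans h1

lemma fp_c_nonneg (hα : 1 < α) (hD : 1 ≤ D) (hψ : Bil D f.ψ) : 0 ≤ f.fp f.c := by
  have hm : f.c ∈ Icc f.c 1 := ⟨le_rfl, f.hc.2.le⟩
  refine le_trans ?_ (fp_lower f hα hD hψ hm)
  exact mul_nonneg (by positivity) (Real.rpow_nonneg (tp_mem f hm).1 _)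

lemma step1 (hα : 1 < α) (hD : 1 ≤ D) (hφ : Bil D f.φ) (hψ : Bil D f.ψ)
    (hc2 : f.c < 1 / 2) (hcv : f.c ≤ f.fp (f.fm f.c)) (hfmp : f.fm (f.fp f.c) ≤ f.c)
    (small : 2 * D ^ 3 * 2 ^ α * (2 * D ^ 2 * f.c) ^ (α - 1) < 1) : f.fp f.c ≤ f.c / 2 := by
  have hc := f.hc.1
  have hcm : f.c ∈ Icc 0 f.c := ⟨hc.le, le_rfl⟩
  have hp0 := fp_c_nonneg f hα hD hψ
  have hpc : f.fp f.c < f.c := f.hright f.c ⟨le_rfl, f.hc.2⟩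
  have he : f.c < f.fm f.c := f.hleft f.c ⟨hc, le_rfl⟩
  have hfm1 := fm_le_one f hα hD hφ hcm
  by_contra hcon
  push Not at hcon
  set p := f.fp f.c with hp
  set e := f.fm f.c - f.c with hee
  have he0 : 0 < e := by linarith
  have h1 := fp_c_sub f hα hD hψ (y := f.fm f.c) ⟨he.le, hfm1⟩
  have h1' : (e / (1 - f.c)) ^ α ≤ (2 * e) ^ α := by
    refine Real.rpow_le_rpow (div_nonneg he0.le (by linarith)) ?_ (by linarith)
    rw [div_le_iff₀ (by linarith)]
    nlinarith
  have h1'' : f.c - p ≤ D * (2 ^ α * e ^ α) := by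
    rw [← Real.mul_rpow (by norm_num) he0.le]
    have : D * (e / (1 - f.c)) ^ α ≤ D * (2 * e) ^ α := by gcongr
    linarith
  have h2 := fm_c_sub f hα hφ (x := p) ⟨hp0, hpc.le⟩
  have hd : (f.c - p) / f.c ∈ Icc (0:ℝ) 1 := hm_mem f ⟨hp0, hpc.le⟩
  have hdα : ((f.c - p) / f.c) ^ α ≤ (f.c - p) / f.c := by
    have := Real.rpow_le_rpow_of_exponent_ge' hd.1 hd.2 zero_le_one hα.le
    rwa [Real.rpow_one] at this
  have h3 := (fm_lower f hα hD hφ (x := p) ⟨hp0, hpc.le⟩).trans hfmp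
  have hu0 := f.hu.1
  have hu : f.u ≤ 2 * D * f.c := by
    have e1 : D⁻¹ * f.u / f.c * p = (f.u * p) / (D * f.c) := by field_simp
    rw [e1, div_le_iff₀ (by positivity)] at h3
    have : f.u * (f.c / 2) ≤ f.c * (D * f.c) := by
      refine le_trans ?_ h3
      gcongr
    have : f.c * f.u ≤ f.c * (2 * D * f.c) := by linarith
    exact le_of_mul_le_mul_left this hc
  have h4 : e ≤ D * (2 * D * f.c * ((f.c - p) / f.c)) := by
    have : D * (f.u * ((f.c - p) / f.c) ^ α) ≤ D * (2 * D * f.c * ((f.c - p) / f.c)) := by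
      have := Real.rpow_nonneg hd.1 α
      gcongr
    linarith
  have h5 : e ≤ 2 * D ^ 2 * (f.c - p) := by
    have : D * (2 * D * f.c * ((f.c - p) / f.c)) = 2 * D ^ 2 * (f.c - p) := by
      field_simp
    linarith
  have h6 : e ≤ 2 * D ^ 2 * f.c := by
    have : 2 * D ^ 2 * (f.c - p) ≤ 2 * D ^ 2 * f.c := by gcongr; linarith
    linarith
  have h7 : e ^ (α - 1) ≤ (2 * D ^ 2 * f.c) ^ (α - 1) :=
    Real.rpow_le_rpow he0.le h6 (by linarith)
  have h8 : e ^ α = e ^ (α - 1) * e := by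
    rw [← Real.rpow_add_one he0.ne']; congr 1; ring
  have h9 : e ≤ 2 * D ^ 2 * (D * (2 ^ α * (e ^ (α - 1) * e))) := by
    rw [← h8]
    refine h5.trans ?_
    gcongr
  have h10 : 2 * D ^ 3 * 2 ^ α * e ^ (α - 1) < 1 := by
    refine lt_of_le_of_lt ?_ small
    gcongr
  have h11 : 2 * D ^ 2 * (D * (2 ^ α * (e ^ (α - 1) * e))) =
      (2 * D ^ 3 * 2 ^ α * e ^ (α - 1)) * e := by ring
  rw [h11] at h9
  nlinarith

lemma step2 (hα : 1 < α) (hD : 1 ≤ D) (hψ : Bil D f.ψ)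
    (hc2 : f.c < 1 / 2) (hp : f.fp f.c ≤ f.c / 2) {B : ℝ} (hB2 : 2 ≤ B)
    (hB : 3 * D * 2 ^ α ≤ B ^ (α - 1)) (k : ℕ) : ∀ w : ℝ, 0 ≤ w → 
    (∀ j < k, f.fp^[j] w ∈ Icc f.c 1) → 3 / 4 * f.c ≤ f.fp^[k] w →
    f.c ≤ (B * w) ^ (α ^ k) := by
  have hc := f.hc.1
  have hB0 : 0 < B := by linarith
  induction k with
  | zero =>
    intro w hw0 _ hw
    simp only [iterate_zero, id] at hw
    rw [pow_zero, Real.rpow_one]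
    nlinarith
  | succ k ih =>
    intro w hw0 hj hw
    have hwm : w ∈ Icc f.c 1 := hj 0 (by omega)
    have hfw : 3 / 4 * f.c ≤ f.fp w := by
      cases k with
      | zero => exact hw
      | succ k =>
        have := (hj 1 (by omega)).1
        simp only [iterate_one] at this
        linarith
    have h1 := ih (f.fp w) (by linarith) (fun j hjk => hj (j + 1) (by omega)) hw
    refine h1.trans ?_
    rw [pow_succ', Real.rpow_mul (by positivity)]
    refine Real.rpow_le_rpow (mul_nonneg hB0.le (by linarith)) ?_ (by positivity)
    have h2 := fp_c_sub f hα hD hψ hwm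
    have h3 : ((w - f.c) / (1 - f.c)) ^ α ≤ (2 * w) ^ α := by
      refine Real.rpow_le_rpow (tp_mem f hwm).1 ?_ (by linarith)
      rw [div_le_iff₀ (by linarith)]
      nlinarith
    rw [Real.mul_rpow (by norm_num) hw0] at h3
    have h4 : f.fp w ≤ 3 * D * 2 ^ α * w ^ α := by
      have : D * ((w - f.c) / (1 - f.c)) ^ α ≤ D * (2 ^ α * w ^ α) := by gcongr
      linarith
    rw [Real.mul_rpow hB0.le hw0]
    have h5 : B ^ α = B * B ^ (α - 1) := by
      rw [mul_comm, ← Real.rpow_add_one hB0.ne']; congr 1; ring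
    rw [h5, mul_assoc]
    have h6 := Real.rpow_nonneg hw0 α
    have h7 : 3 * D * 2 ^ α * w ^ α ≤ B ^ (α - 1) * w ^ α := by gcongr
    have := h4.trans h7
    gcongr

lemma fm_iter_lower (hα : 1 < α) (hD : 1 ≤ D) (hφ : Bil D f.φ) {x : ℝ} (hx : 0 ≤ x) (k : ℕ)
    (h : ∀ j < k, f.fm^[j] x < f.c) : (D⁻¹ * f.u / f.c) ^ k * x ≤ f.fm^[k] x := by
  have hu := f.hu.1
  have hc := f.hc.1
  induction k with
  | zero => simp
  | succ k ih =>
    have h1 := ih fun j hj => h j (by omega)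
    have h0 : 0 ≤ (D⁻¹ * f.u / f.c) ^ k * x := by positivity
    rw [iterate_succ_apply']
    refine le_trans ?_ (fm_lower f hα hD hφ ⟨h0.trans h1, (h k (by omega)).le⟩)
    rw [pow_succ', mul_assoc]
    gcongr

lemma step3 (hα : 1 < α) (hD : 1 ≤ D) (hφ : Bil D f.φ) (hψ : Bil D f.ψ)
    {B : ℝ} (hB2 : 2 ≤ B) (hU : f.c ^ α⁻¹ ≤ B * D * f.u)
    (small : B * D ^ 2 * f.c ^ (1 - α⁻¹) ≤ 1) {r : ℝ} (hr : f.c < r) (hr1 : r ≤ 1) (n : ℕ)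
    (hn : α ≤ n) (h : ∀ j ≤ n, f.fm^[j] (f.fp r) < f.c) :
    r ≤ (1 + B * D ^ 3) * f.c := by
  have hc := f.hc.1
  have hc1 := f.hc.2
  have hrm : r ∈ Icc f.c 1 := ⟨hr.le, hr1⟩
  have h1 := fp_lower f hα hD hψ hrm
  have hrc : 0 < r - f.c := by linarith
  have h2 : (r - f.c) ^ α ≤ ((r - f.c) / (1 - f.c)) ^ α := by
    refine Real.rpow_le_rpow hrc.le ?_ (by linarith)
    rw [le_div_iff₀ (by linarith)]
    nlinarith
  have h3 : D⁻¹ * (r - f.c) ^ α ≤ f.fp r := le_trans (by gcongr) h1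
  have h30 : 0 ≤ D⁻¹ * (r - f.c) ^ α :=
    mul_nonneg (by positivity) (Real.rpow_nonneg hrc.le _)
  have h4 := (fm_iter_lower f hα hD hφ (h30.trans h3) n fun j hj => h j hj.le).trans
    (h n le_rfl).le
  set μ := (B * D ^ 2 * f.c ^ (1 - α⁻¹))⁻¹ with hμ
  have hP : 0 < f.c ^ (1 - α⁻¹) := Real.rpow_pos_of_pos hc _
  have hBD : 0 < B * D ^ 2 * f.c ^ (1 - α⁻¹) := by positivity
  have hμ1 : 1 ≤ μ := (one_le_inv₀ hBD).2 small
  have hsplit : f.c ^ (1 - α⁻¹) * f.c ^ α⁻¹ = f.c := by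
    rw [← Real.rpow_add hc]; simp
  have hμl : μ ≤ D⁻¹ * f.u / f.c := by
    rw [hμ, inv_le_iff_one_le_mul₀ hBD]
    have e1 : D⁻¹ * f.u / f.c * (B * D ^ 2 * f.c ^ (1 - α⁻¹)) =
        (B * D * f.u) * f.c ^ (1 - α⁻¹) / f.c := by
      field_simp
    rw [e1, le_div_iff₀ hc, one_mul]
    calc f.c = f.c ^ α⁻¹ * f.c ^ (1 - α⁻¹) := by rw [mul_comm, hsplit]
      _ ≤ _ := by gcongr
  have h5 : μ ^ α ≤ (D⁻¹ * f.u / f.c) ^ n := by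
    calc μ ^ α ≤ μ ^ (n : ℝ) := Real.rpow_le_rpow_of_exponent_le hμ1 hn
      _ = μ ^ n := Real.rpow_natCast _ _
      _ ≤ _ := by gcongr
  have h6 : μ ^ α * (D⁻¹ * (r - f.c) ^ α) ≤ f.c := by
    refine le_trans ?_ h4
    have hμ0 : 0 ≤ μ ^ α := Real.rpow_nonneg (by linarith) _
    exact mul_le_mul h5 h3 h30 (hμ0.trans h5)
  have h7 : (μ * (r - f.c)) ^ α ≤ (D * f.c ^ α⁻¹) ^ α := by
    rw [Real.mul_rpow (by linarith) hrc.le, Real.mul_rpow (by linarith) (by positivity),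
      ← Real.rpow_mul hc.le, inv_mul_cancel₀ (by linarith), Real.rpow_one]
    have hDα : D ≤ D ^ α := by
      have := Real.rpow_le_rpow_of_exponent_le hD hα.le
      rwa [Real.rpow_one] at this
    have e2 : μ ^ α * (r - f.c) ^ α = D * (μ ^ α * (D⁻¹ * (r - f.c) ^ α)) := by
      field_simp
    rw [e2]
    calc D * (μ ^ α * (D⁻¹ * (r - f.c) ^ α)) ≤ D * f.c := by gcongr
      _ ≤ D ^ α * f.c := by gcongr
  have h8 : μ * (r - f.c) ≤ D * f.c ^ α⁻¹ :=
    (Real.rpow_le_rpow_iff (mul_nonneg (by linarith) hrc.le) (by positivity)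
      (by linarith)).1 h7
  rw [hμ, inv_mul_le_iff₀ hBD] at h8
  have e3 : B * D ^ 2 * f.c ^ (1 - α⁻¹) * (D * f.c ^ α⁻¹) = B * D ^ 3 * f.c := by
    calc _ = B * D ^ 3 * (f.c ^ (1 - α⁻¹) * f.c ^ α⁻¹) := by ring
      _ = _ := by rw [hsplit]
  rw [e3] at h8
  linarith

lemma step4 (hα : 1 < α) (hD : 1 ≤ D) (hψ : Bil D f.ψ) (hc2 : f.c < 1 / 2)
    {M K : ℝ} (hM2 : 2 ≤ M) (hM : 2 ^ α * D ≤ M ^ (α - 1))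
    (hK : 2 * D * α * M ^ (α - 1) ≤ K) (k : ℕ) : ∀ y : ℝ,
    (∀ j < k, f.fp^[j] y ∈ Icc f.c 1) → f.fp^[k] y ≤ M * f.c →
    y ≤ M * f.c ^ ((α ^ k)⁻¹) ∧ DifferentiableAt ℝ (f.fp^[k]) y ∧ 0 ≤ deriv (f.fp^[k]) y ∧
    deriv (f.fp^[k]) y ≤ K ^ k * f.c ^ (1 - (α ^ k)⁻¹) := by
  have hc := f.hc.1
  have hα0 : 0 < α := by linarith
  have hM0 : 0 < M := by linarith
  have hK0 : 0 < K := lt_of_lt_of_le (by positivity) hK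
  induction k with
  | zero =>
    intro y _ hy
    refine ⟨by simpa using hy, ?_, ?_, ?_⟩ <;> simp [differentiableAt_id]
  | succ k ih =>
    intro y hj hy
    have hym : y ∈ Icc f.c 1 := hj 0 (by omega)
    obtain ⟨i1, i2, i3, i4⟩ := ih (f.fp y) (fun j hjk => hj (j + 1) (by omega)) hy
    obtain ⟨g1, g2, g3⟩ := fp_deriv f hα hD hψ hym
    have ht := tp_mem f hym
    have hl := fp_lower f hα hD hψ hym
    set t := (y - f.c) / (1 - f.c) with htdef
    have hE : ((α ^ (k + 1))⁻¹ : ℝ) * α = (α ^ k)⁻¹ := by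
      rw [pow_succ]; field_simp
    set E : ℝ := (α ^ (k + 1))⁻¹ with hEdef
    have hE0 : 0 < E := by positivity
    have hE1 : E ≤ 1 := inv_le_one_of_one_le₀ (one_le_pow₀ hα.le)
    have hcE : 0 < f.c ^ E := Real.rpow_pos_of_pos hc _
    have hMα : M ^ α = M * M ^ (α - 1) := by
      rw [mul_comm, ← Real.rpow_add_one hM0.ne']; congr 1; ring
    have h1 : t ^ α ≤ (M / 2 * f.c ^ E) ^ α := by
      rw [Real.mul_rpow (by positivity) hcE.le, ← Real.rpow_mul hc.le, hE,
        Real.div_rpow hM0.le (by norm_num), hMα]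
      have a1 : t ^ α ≤ D * f.fp y := by
        rwa [inv_mul_le_iff₀ (by linarith)] at hl
      have a2 : D ≤ M ^ (α - 1) / 2 ^ α := by
        rw [le_div_iff₀ (by positivity)]; linarith
      calc t ^ α ≤ D * f.fp y := a1
        _ ≤ D * (M * f.c ^ ((α ^ k)⁻¹)) := by gcongr
        _ ≤ (M ^ (α - 1) / 2 ^ α) * (M * f.c ^ ((α ^ k)⁻¹)) := by gcongr
        _ = _ := by ring
    have h2 : t ≤ M / 2 * f.c ^ E :=
      (Real.rpow_le_rpow_iff ht.1 (by positivity) hα0).1 h1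
    have hcc : f.c ≤ f.c ^ E := by
      have := Real.rpow_le_rpow_of_exponent_ge hc f.hc.2.le hE1
      rwa [Real.rpow_one] at this
    have hd : deriv f.fp y ≤ K * f.c ^ ((α ^ k)⁻¹ - E) := by
      have b1 : t ^ (α - 1) ≤ M ^ (α - 1) * f.c ^ ((α ^ k)⁻¹ - E) := by
        have : ((α ^ k)⁻¹ : ℝ) - E = E * (α - 1) := by rw [← hE]; ring
        rw [this, Real.rpow_mul hc.le, ← Real.mul_rpow hM0.le hcE.le]
        refine Real.rpow_le_rpow ht.1 (h2.trans ?_) (by linarith)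
        gcongr; linarith
      have b2 : α * t ^ (α - 1) / (1 - f.c) ≤ 2 * (α * t ^ (α - 1)) := by
        rw [div_le_iff₀ (by linarith)]
        have : 0 ≤ α * t ^ (α - 1) := mul_nonneg hα0.le (Real.rpow_nonneg ht.1 _)
        nlinarith
      have hcp : 0 < f.c ^ ((α ^ k)⁻¹ - E) := Real.rpow_pos_of_pos hc _
      calc deriv f.fp y ≤ D * (α * t ^ (α - 1) / (1 - f.c)) := g3
        _ ≤ D * (2 * (α * t ^ (α - 1))) := by gcongr
        _ ≤ D * (2 * (α * (M ^ (α - 1) * f.c ^ ((α ^ k)⁻¹ - E)))) := by gcongr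
        _ = 2 * D * α * M ^ (α - 1) * f.c ^ ((α ^ k)⁻¹ - E) := by ring
        _ ≤ _ := by gcongr
    have hder : HasDerivAt (f.fp^[k + 1]) (deriv (f.fp^[k]) (f.fp y) * deriv f.fp y) y := by
      rw [iterate_succ]
      exact HasDerivAt.comp y i2.hasDerivAt g1.hasDerivAt
    refine ⟨?_, hder.differentiableAt, ?_, ?_⟩
    · have : y ≤ f.c + t := by
        have : y - f.c = t * (1 - f.c) := by
          rw [htdef]; field_simp [show (1 - f.c) ≠ 0 by linarith]
        nlinarith [ht.1]
      nlinarith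
    · rw [hder.deriv]; exact mul_nonneg i3 g2
    · rw [hder.deriv]
      calc _ ≤ (K ^ k * f.c ^ (1 - (α ^ k)⁻¹)) * (K * f.c ^ ((α ^ k)⁻¹ - E)) :=
            mul_le_mul i4 hd g2 (by positivity)
        _ = K ^ (k + 1) * (f.c ^ (1 - (α ^ k)⁻¹) * f.c ^ ((α ^ k)⁻¹ - E)) := by ring
        _ = _ := by
          rw [← Real.rpow_add hc]; congr 2; ring

lemma step5_point (hα : 1 < α) (hD : 1 ≤ D) (hφ : Bil D f.φ) {M B E : ℝ}
    (hB2 : 2 ≤ B) (hM2 : 2 ≤ M) (hE1 : E ≤ α⁻¹)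
    (hU : f.c ^ E ≤ B * D * f.u)
    (small : M * B * D ^ 2 * f.c ^ (1 - α⁻¹) ≤ 1 / 2) {x : ℝ} (hx : x ∈ Icc 0 f.c)
    (hxM : f.fm x ≤ M * f.c) :
    DifferentiableAt ℝ f.fm x ∧ (2 * B * D ^ 2)⁻¹ * f.c ^ (-(1 - E)) ≤ deriv f.fm x := by
  have hc := f.hc.1
  have hcE : 0 < f.c ^ E := Real.rpow_pos_of_pos hc _
  have hu : 0 < f.u := by
    have : 0 < B * D * f.u := lt_of_lt_of_le hcE hU
    exact pos_of_mul_pos_right this (by positivity)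
  have hl := (fm_lower' f hα hφ hx).trans hxM
  have hh := hm_mem f hx
  set h := (f.c - x) / f.c with hdef
  have hz : 1 - h ^ α ≤ 1 / 2 := by
    rw [inv_mul_le_iff₀ (by linarith)] at hl
    have h1 : f.c ^ α⁻¹ ≤ B * D * f.u :=
      (Real.rpow_le_rpow_of_exponent_ge hc f.hc.2.le hE1).trans hU
    have hsplit : f.c ^ (1 - α⁻¹) * f.c ^ α⁻¹ = f.c := by
      rw [← Real.rpow_add hc]; simp
    have hP : 0 < f.c ^ (1 - α⁻¹) := Real.rpow_pos_of_pos hc _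
    have h2 : D * (M * f.c) ≤ f.u * (1 / 2) := by
      calc D * (M * f.c) = D * M * f.c ^ (1 - α⁻¹) * f.c ^ α⁻¹ := by
            rw [mul_assoc, hsplit]; ring
        _ ≤ D * M * f.c ^ (1 - α⁻¹) * (B * D * f.u) := by gcongr
        _ = (M * B * D ^ 2 * f.c ^ (1 - α⁻¹)) * f.u := by ring
        _ ≤ 1 / 2 * f.u := by gcongr
        _ = _ := by ring
    exact le_of_mul_le_mul_left (hl.trans h2) hu
  have hxc : x < f.c := by
    refine lt_of_le_of_ne hx.2 fun hxe => ?_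
    rw [hdef, hxe, sub_self, zero_div, Real.zero_rpow (by linarith)] at hz
    norm_num at hz
  have hh0 : 0 < h := div_pos (by linarith) hc
  obtain ⟨g1, g2⟩ := fm_deriv f hα hD hφ (x := x) ⟨hx.1, hxc⟩
  refine ⟨g1, le_trans ?_ g2⟩
  have h3 : 1 / 2 ≤ h ^ (α - 1) := by
    have := Real.rpow_le_rpow_of_exponent_ge hh0 hh.2 (show α - 1 ≤ α by linarith)
    linarith
  have h4 : f.c ^ (-(1 - E)) = f.c ^ E / f.c := by
    rw [neg_sub, Real.rpow_sub hc, Real.rpow_one]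
  rw [h4]
  calc (2 * B * D ^ 2)⁻¹ * (f.c ^ E / f.c) ≤ (2 * B * D ^ 2)⁻¹ * (B * D * f.u / f.c) := by gcongr
    _ = D⁻¹ * (f.u * ((1 / 2) / f.c)) := by field_simp
    _ ≤ _ := by gcongr

lemma step5 {Q L : ℝ} (hQ : 0 ≤ Q)
    (hpt : ∀ x ∈ Icc 0 f.c, f.fm x ≤ L → DifferentiableAt ℝ f.fm x ∧ Q ≤ deriv f.fm x)
    (hL : f.c ≤ L) (k : ℕ) : ∀ x : ℝ,
    (∀ j < k, f.fm^[j] x ∈ Icc 0 f.c) → f.fm^[k] x ≤ L →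
    DifferentiableAt ℝ (f.fm^[k]) x ∧ Q ^ k ≤ deriv (f.fm^[k]) x := by
  induction k with
  | zero => intro x _ _; simp [differentiableAt_id]
  | succ k ih =>
    intro x hj hx
    obtain ⟨i1, i2⟩ := ih (f.fm x) (fun j hjk => hj (j + 1) (by omega)) hx
    have hfx : f.fm x ≤ L := by
      cases k with
      | zero => exact hx
      | succ k => exact (hj 1 (by omega)).2.trans hL
    obtain ⟨g1, g2⟩ := hpt x (hj 0 (by omega)) hfx
    have hder : HasDerivAt (f.fm^[k + 1]) (deriv (f.fm^[k]) (f.fm x) * deriv f.fm x) x := by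
      rw [iterate_succ]
      exact HasDerivAt.comp x i1.hasDerivAt g1.hasDerivAt
    refine ⟨hder.differentiableAt, ?_⟩
    rw [hder.deriv, pow_succ]
    exact mul_le_mul i2 g2 hQ ((pow_nonneg hQ k).trans i2)

end steps

/-- **Derivatives of returns for small critical point.** For every `δ < ∞` there
exist `K < ∞` and `γ > 0` such that if `f ∈ L_δ` is `(a,b)`-renormalizable with
`b > α + 1` and `c < γ`, then `Df₋^b(x) ≥ K⁻ᵇ c^(-b(1-α⁻ᵃ))` for every
`x ∈ f₋⁻ᵇ(C)` and `Df₊^a(y) ≤ Kᵃ c^(1-α⁻ᵃ)` for every `y ∈ f₊⁻ᵃ(C)`. -/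
theorem corner_return_derivatives (α : ℝ) (hα : 1 < α) (δ : ℝ) :
    ∃ (K γ : ℝ), 0 < K ∧ 0 < γ ∧ ∀ (f : LorenzMap α) (a b : ℕ) (l r : ℝ),
      f.memL δ → ABRenormWith f a b l r → α + 1 < (b : ℝ) → f.c < γ →
      (∀ x : ℝ, (∀ i < b, f.fm^[i] x ∈ Set.Icc 0 f.c) → f.fm^[b] x ∈ Set.Icc l r →
        K⁻¹ ^ b * f.c ^ (-(b : ℝ) * (1 - (α ^ a)⁻¹)) ≤ deriv (f.fm^[b]) x) ∧
      (∀ y : ℝ, (∀ i < a, f.fp^[i] y ∈ Set.Icc f.c 1) → f.fp^[a] y ∈ Set.Icc l r →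
        deriv (f.fp^[a]) y ≤ K ^ a * f.c ^ (1 - (α ^ a)⁻¹)) := by
  set D := Real.exp |δ| with hDdef
  have hD : 1 ≤ D := Real.one_le_exp (abs_nonneg δ)
  have hα0 : 0 < α := by linarith
  have hlim := tendsto_rpow_atTop (show 0 < α - 1 by linarith)
  obtain ⟨B, hB2, hB⟩ := ((eventually_ge_atTop (2:ℝ)).and
    (hlim.eventually_ge_atTop (3 * D * 2 ^ α))).exists
  obtain ⟨M, hM2, hMB, hM⟩ := ((eventually_ge_atTop (2:ℝ)).and
    ((eventually_ge_atTop (1 + B * D ^ 3)).and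
    (hlim.eventually_ge_atTop (2 ^ α * D)))).exists
  have hinv : α⁻¹ < 1 := inv_lt_one_of_one_lt₀ hα
  have hs1 : ∀ᶠ c : ℝ in 𝓝 0, 2 * D ^ 3 * 2 ^ α * (2 * D ^ 2 * c) ^ (α - 1) < 1 := by
    have hcont : ContinuousAt (fun c : ℝ => 2 * D ^ 3 * 2 ^ α * (2 * D ^ 2 * c) ^ (α - 1)) 0 := by
      refine continuousAt_const.mul (ContinuousAt.rpow_const ?_ (Or.inr (by linarith)))
      fun_prop
    refine hcont.eventually_lt_const ?_
    beta_reduce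
    rw [mul_zero, Real.zero_rpow (by linarith), mul_zero]
    exact one_pos
  have hs2 : ∀ᶠ c : ℝ in 𝓝 0, M * B * D ^ 2 * c ^ (1 - α⁻¹) < 1 / 2 := by
    have hcont : ContinuousAt (fun c : ℝ => M * B * D ^ 2 * c ^ (1 - α⁻¹)) 0 :=
      continuousAt_const.mul (ContinuousAt.rpow_const continuousAt_id (Or.inr (by linarith)))
    refine hcont.eventually_lt_const ?_
    beta_reduce
    rw [Real.zero_rpow (by linarith), mul_zero]
    norm_num
  obtain ⟨ε, hε, hball⟩ := Metric.eventually_nhds_iff.1 (hs1.and hs2)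
  refine ⟨max (2 * B * D ^ 2) (2 * D * α * M ^ (α - 1)), min ε (1 / 2),
    lt_max_of_lt_left (by positivity), lt_min hε (by norm_num), ?_⟩
  intro f a b l r hmem hren hb hcγ
  have hc := f.hc.1
  have hc1 := f.hc.2
  have hc2 : f.c < 1 / 2 := hcγ.trans_le (min_le_right _ _)
  obtain ⟨small1, small2⟩ := hball (y := f.c) (by
    rw [Real.dist_eq, sub_zero, abs_of_pos hc]; exact hcγ.trans_le (min_le_left _ _))
  have hφ : Bil D f.φ := sdiffeo_bil f.hφ hmem.1
  have hψ : Bil D f.ψ := sdiffeo_bil f.hψ hmem.2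
  obtain ⟨⟨⟨g, hl0, hlc, hcr, hr1, -⟩, -⟩, ha0, hb0, hA1, -, hA3, -, hC1, -⟩ := hren
  have hcm : f.c ∈ Icc 0 f.c := ⟨hc.le, le_rfl⟩
  have hTm : ∀ x, x < f.c → f.toFun x = f.fm x := fun x hx => by
    unfold LorenzMap.toFun; rw [if_pos hx]
  have hTp : ∀ x, f.c ≤ x → f.toFun x = f.fp x := fun x hx => by
    unfold LorenzMap.toFun; rw [if_neg (not_lt.2 hx)]
  have hfm1 := fm_le_one f hα hD hφ hcm
  have he : f.c < f.fm f.c := f.hleft f.c ⟨hc, le_rfl⟩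
  -- orbits of the left critical value
  have horb : ∀ c' ∈ Ico l f.c, ∃ w, f.c < w ∧ w ≤ f.fm f.c ∧
      (∀ j < a, f.fp^[j] w ∈ Icc f.c w) ∧ f.fp^[a] w = c' := by
    intro c' hc'
    obtain ⟨x, hx, hxc'⟩ := hA3 hc'
    have hxm : x ∈ Icc 0 f.c := ⟨hl0.trans hx.1, hx.2.le⟩
    have hw : ∀ j < a, f.c < f.toFun^[j] (f.fm x) := fun j hj => by
      have := hA1 (j + 1) (by omega) (by omega) x hx
      rwa [iterate_succ_apply, hTm x hx.2] at this
    have hw' : ∀ j ≤ a, f.toFun^[j] (f.fm x) = f.fp^[j] (f.fm x) := fun j hj =>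
      toFun_iter_fp f _ j fun i hi => (hw i (by omega)).le
    have hlow : ∀ j < a, f.c ≤ f.fp^[j] (f.fm x) := fun j hj => by
      rw [← hw' j hj.le]; exact (hw j hj).le
    refine ⟨f.fm x, hw 0 ha0, fm_mono f hα hD hφ hxm hcm hx.2.le, fun j hj => ⟨hlow j hj, ?_⟩, ?_⟩
    · exact fp_iter_le f hψ (fm_le_one f hα hD hφ hxm) j fun i hi => hlow i (by omega)
    · rw [← hw' a le_rfl, ← hTm x hx.2, ← iterate_succ_apply, hxc']
  have hcv : f.c ≤ f.fp (f.fm f.c) := by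
    by_contra hcon
    push Not at hcon
    obtain ⟨c', h1, h2⟩ := exists_between (max_lt hlc hcon)
    obtain ⟨w, hw1, hw2, hw3, hw4⟩ := horb c' ⟨(le_max_left _ _).trans h1.le, h2⟩
    obtain ⟨n, rfl⟩ : ∃ n, a = n + 1 := ⟨a - 1, by omega⟩
    rw [iterate_succ_apply'] at hw4
    have h3 := hw3 n (by omega)
    have h4 := h3.2.trans hw2
    have := fp_mono f hα hD hψ (x := f.fp^[n] w) (y := f.fm f.c) ⟨h3.1, h4.trans hfm1⟩
      ⟨he.le, hfm1⟩ h4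
    rw [hw4] at this
    linarith [(le_max_right l (f.fp (f.fm f.c))).trans_lt h1]
  -- orbits of the right side
  have hb3 : 3 ≤ b := by
    have : (2:ℝ) < b := by linarith
    exact_mod_cast this
  have hright_orb : ∀ j, j ≤ b - 1 → f.fm^[j] (f.fp r) < f.c := by
    have h1 : ∀ j ≤ b - 1, f.toFun^[j] (f.fp r) < f.c := fun j hj => by
      have := hC1 (j + 1) (by omega) (by omega) r ⟨hcr, le_rfl⟩
      rwa [iterate_succ_apply, hTp r hcr.le] at this
    intro j hj
    rw [← toFun_iter_fm f _ j fun i hi => h1 i (by omega)]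
    exact h1 j hj
  have hp0 := fp_c_nonneg f hα hD hψ
  have hpr : f.fp f.c ≤ f.fp r := fp_mono f hα hD hψ ⟨le_rfl, hc1.le⟩ ⟨hcr.le, hr1⟩ hcr.le
  have hfmp : f.fm (f.fp f.c) ≤ f.c := by
    have h0 : f.fp r < f.c := hright_orb 0 (by omega)
    have h1 : f.fm (f.fp r) < f.c := hright_orb 1 (by omega)
    exact (fm_mono f hα hD hφ ⟨hp0, by linarith⟩ ⟨by linarith, h0.le⟩ hpr).trans h1.le
  have hp := step1 f hα hD hφ hψ hc2 hcv hfmp small1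
  have hU : f.c ^ ((α ^ a)⁻¹) ≤ B * D * f.u := by
    obtain ⟨w, hw1, hw2, hw3, hw4⟩ := horb (max l (3 / 4 * f.c))
      ⟨le_max_left _ _, max_lt hlc (by linarith)⟩
    have h1 := step2 f hα hD hψ hc2 hp hB2 hB a w (by linarith)
      (fun j hj => ⟨(hw3 j hj).1, (hw3 j hj).2.trans (hw2.trans hfm1)⟩)
      (by rw [hw4]; exact le_max_right _ _)
    have hBw : 0 ≤ B * w := mul_nonneg (by linarith) (by linarith)
    have h2 : f.c ^ ((α ^ a)⁻¹) ≤ B * w := by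
      have := Real.rpow_le_rpow hc.le h1 (show 0 ≤ (α ^ a)⁻¹ by positivity)
      rwa [← Real.rpow_mul hBw, mul_inv_cancel₀ (by positivity), Real.rpow_one] at this
    have h3 := hw2.trans (fm_c_le f hα hφ)
    calc _ ≤ B * w := h2
      _ ≤ B * (D * f.u) := by gcongr
      _ = _ := by ring
  have hE1 : (α ^ a)⁻¹ ≤ α⁻¹ := by
    refine inv_anti₀ hα0 ?_
    exact le_self_pow₀ hα.le (by omega)
  have hP : 0 < f.c ^ (1 - α⁻¹) := Real.rpow_pos_of_pos hc _
  have hr : r ≤ M * f.c := by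
    have hU' : f.c ^ α⁻¹ ≤ B * D * f.u :=
      (Real.rpow_le_rpow_of_exponent_ge hc hc1.le hE1).trans hU
    have hsm : B * D ^ 2 * f.c ^ (1 - α⁻¹) ≤ 1 := by
      have h0 : 0 ≤ B * D ^ 2 * f.c ^ (1 - α⁻¹) := by positivity
      have h1 : M * B * D ^ 2 * f.c ^ (1 - α⁻¹) = M * (B * D ^ 2 * f.c ^ (1 - α⁻¹)) := by ring
      rw [h1] at small2
      nlinarith
    have hbα : α ≤ ((b - 1 : ℕ) : ℝ) := by
      rw [Nat.cast_sub (by omega)]; push_cast; linarith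
    refine (step3 f hα hD hφ hψ hB2 hU' hsm hcr hr1 (b - 1) hbα hright_orb).trans ?_
    gcongr
  constructor
  · intro x hx hxb
    set K := max (2 * B * D ^ 2) (2 * D * α * M ^ (α - 1)) with hK
    have hcp : 0 < f.c ^ (-(1 - (α ^ a)⁻¹)) := Real.rpow_pos_of_pos hc _
    have h1 := (step5 f (Q := (2 * B * D ^ 2)⁻¹ * f.c ^ (-(1 - (α ^ a)⁻¹))) (L := M * f.c)
      (by positivity)
      (fun z hz hzM => step5_point f hα hD hφ hB2 hM2 hE1 hU small2.le hz hzM)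
      (by nlinarith) b x hx (hxb.2.trans hr)).2
    refine le_trans ?_ h1
    have h2 : f.c ^ (-(b : ℝ) * (1 - (α ^ a)⁻¹)) = (f.c ^ (-(1 - (α ^ a)⁻¹))) ^ b := by
      rw [← Real.rpow_natCast (f.c ^ (-(1 - (α ^ a)⁻¹))), ← Real.rpow_mul hc.le]; congr 1; ring
    rw [h2, ← mul_pow]
    have hKle : 2 * B * D ^ 2 ≤ K := le_max_left _ _
    have hK0 : 0 < K := lt_of_lt_of_le (by positivity) hKle
    gcongr
  · intro y hy hya
    exact (step4 f hα hD hψ hc2 hM2 hM (le_max_right _ _) a y hy (hya.2.trans hr)).2.2.2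
end
end

section
/- (Flipping Lemma) For every compact interval P ⊂ (0,∞), every δ < ∞ and every σ ∈ (0,1) there exist N < ∞ and γ > 0 such that the following holds for every f ∈ L_δ that is (a,b)-renormalizable with min{a,b} ≥ N and a/b ∈ P: if c(f) < γ then 1 − c(Rf) < σ·c(f), and if 1 − c(f) < γ then c(Rf) < σ·(1 − c(f)). -/
open Set Filter Topology MeasureTheory Function

noncomputable section

/-- The abstract estimates used in the proof; symmetric under `x ↦ 1 - x`. -/
structure FlipCore (α M u v c l r : ℝ) (a b : ℕ) (F G : ℝ → ℝ) : Prop where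
  u0 : 0 ≤ u
  u1 : u ≤ 1
  v0 : 0 ≤ v
  v1 : v ≤ 1
  c0 : 0 < c
  c1 : c < 1
  l0 : 0 ≤ l
  lc : l < c
  cr : c < r
  r1 : r ≤ 1
  F0 : F 0 = 0
  Fc1 : F c ≤ 1
  Fc : c < F c
  G1 : G 1 = 1
  Gc0 : 0 ≤ G c
  Gc : G c < c
  A1 : ∀ x y, 0 ≤ x → x ≤ y → y ≤ c →
    u * (((c - x) / c) ^ α - ((c - y) / c) ^ α) ≤ M * (F y - F x)
  A2 : ∀ x y, 0 ≤ x → x ≤ y → y ≤ c →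
    F y - F x ≤ M * (u * (((c - x) / c) ^ α - ((c - y) / c) ^ α))
  B1 : ∀ x y, c ≤ x → x ≤ y → y ≤ 1 →
    v * (((y - c) / (1 - c)) ^ α - ((x - c) / (1 - c)) ^ α) ≤ M * (G y - G x)
  B2 : ∀ x y, c ≤ x → x ≤ y → y ≤ 1 →
    G y - G x ≤ M * (v * (((y - c) / (1 - c)) ^ α - ((x - c) / (1 - c)) ^ α))
  H1 : ∀ i < a, ∀ x ∈ Ico l c, c < G^[i] (F x)
  H2 : Ico l c ⊆ (fun x => G^[a] (F x)) '' Ico l c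
  H3 : ∀ i < b, ∀ x ∈ Ioc c r, F^[i] (G x) < c
  H4 : Ioc c r ⊆ (fun x => F^[b] (G x)) '' Ioc c r

theorem flip_iterate (G : ℝ → ℝ) (n : ℕ) (x : ℝ) :
    (fun x => 1 - G (1 - x))^[n] x = 1 - G^[n] (1 - x) := by
  induction n with
  | zero => simp
  | succ n ih => rw [iterate_succ_apply', iterate_succ_apply', ih]; simp

theorem FlipCore.flip {α M u v c l r : ℝ} {a b : ℕ} {F G : ℝ → ℝ}
    (h : FlipCore α M u v c l r a b F G) :
    FlipCore α M v u (1 - c) (1 - r) (1 - l) b a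
      (fun x => 1 - G (1 - x)) (fun x => 1 - F (1 - x)) where
  u0 := h.v0
  u1 := h.v1
  v0 := h.u0
  v1 := h.u1
  c0 := by linarith [h.c1]
  c1 := by linarith [h.c0]
  l0 := by linarith [h.r1]
  lc := by linarith [h.cr]
  cr := by linarith [h.lc]
  r1 := by linarith [h.l0]
  F0 := by simp [h.G1]
  Fc1 := by simpa using h.Gc0
  Fc := by simpa using h.Gc
  G1 := by simp [h.F0]
  Gc0 := by simpa using h.Fc1
  Gc := by simpa using h.Fc
  A1 := by
    intro x y hx hxy hy
    have := h.B1 (1 - y) (1 - x) (by linarith) (by linarith) (by linarith)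
    rw [show 1 - c - x = 1 - x - c by ring, show 1 - c - y = 1 - y - c by ring]
    linarith
  A2 := by
    intro x y hx hxy hy
    have := h.B2 (1 - y) (1 - x) (by linarith) (by linarith) (by linarith)
    rw [show 1 - c - x = 1 - x - c by ring, show 1 - c - y = 1 - y - c by ring]
    linarith
  B1 := by
    intro x y hx hxy hy
    have := h.A1 (1 - y) (1 - x) (by linarith) (by linarith) (by linarith)
    rw [show x - (1 - c) = c - (1 - x) by ring, show y - (1 - c) = c - (1 - y) by ring,
      show 1 - (1 - c) = c by ring]
    linarith
  B2 := by
    intro x y hx hxy hy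
    have := h.A2 (1 - y) (1 - x) (by linarith) (by linarith) (by linarith)
    rw [show x - (1 - c) = c - (1 - x) by ring, show y - (1 - c) = c - (1 - y) by ring,
      show 1 - (1 - c) = c by ring]
    linarith
  H1 := by
    intro i hi x hx
    have := h.H3 i hi (1 - x) ⟨by linarith [hx.2], by linarith [hx.1]⟩
    rw [flip_iterate]; simp only [sub_sub_cancel]; linarith
  H2 := by
    intro x hx
    obtain ⟨y, hy, hyx⟩ := h.H4 (show 1 - x ∈ Ioc c r from ⟨by linarith [hx.2], by linarith [hx.1]⟩)
    refine ⟨1 - y, ⟨by linarith [hy.2], by linarith [hy.1]⟩, ?_⟩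
    simp only [flip_iterate, sub_sub_cancel] at hyx ⊢
    linarith
  H3 := by
    intro i hi x hx
    have := h.H1 i hi (1 - x) ⟨by linarith [hx.2], by linarith [hx.1]⟩
    rw [flip_iterate]; simp only [sub_sub_cancel]; linarith
  H4 := by
    intro x hx
    obtain ⟨y, hy, hyx⟩ := h.H2 (show 1 - x ∈ Ico l c from ⟨by linarith [hx.2], by linarith [hx.1]⟩)
    refine ⟨1 - y, ⟨by linarith [hy.2], by linarith [hy.1]⟩, ?_⟩
    simp only [flip_iterate, sub_sub_cancel] at hyx ⊢
    linarith

section estimates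

variable {α M u v c l r : ℝ} {a b : ℕ} {F G : ℝ → ℝ}

theorem FlipCore.Fmono (h : FlipCore α M u v c l r a b F G) (hα : 1 < α) (hM : 1 ≤ M)
    {x y : ℝ} (hx : 0 ≤ x) (hxy : x ≤ y) (hy : y ≤ c) : F x ≤ F y := by
  have h1 := h.A1 x y hx hxy hy
  have h2 : ((c - y) / c) ^ α ≤ ((c - x) / c) ^ α := by
    have := h.c0
    apply Real.rpow_le_rpow (div_nonneg (by linarith) this.le) _ (by linarith)
    gcongr
  have h3 := mul_nonneg h.u0 (sub_nonneg.2 h2)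
  have : 0 ≤ M * (F y - F x) := h3.trans h1
  have := nonneg_of_mul_nonneg_right this (by linarith)
  linarith

theorem FlipCore.Gmono (h : FlipCore α M u v c l r a b F G) (hα : 1 < α) (hM : 1 ≤ M)
    {x y : ℝ} (hx : c ≤ x) (hxy : x ≤ y) (hy : y ≤ 1) : G x ≤ G y := by
  have := h.flip.Fmono hα hM (x := 1 - y) (y := 1 - x) (by linarith) (by linarith) (by linarith)
  simp only [sub_sub_cancel] at this
  linarith

/-- `t ↦ t^α` is `α`-Lipschitz on `[0,1]`. -/
theorem rpow_sub_le (hα : 1 < α) {s t : ℝ} (hs : 0 ≤ s) (hst : s ≤ t) (ht : t ≤ 1) :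
    t ^ α - s ^ α ≤ α * (t - s) := by
  rcases hs.eq_or_lt with rfl | hs
  · rcases hst.eq_or_lt with rfl | h0
    · simp
    rw [Real.zero_rpow (by linarith)]
    have : t ^ α ≤ t ^ (1:ℝ) := Real.rpow_le_rpow_of_exponent_ge h0 ht hα.le
    rw [Real.rpow_one] at this
    nlinarith
  have ht0 : 0 < t := hs.trans_le hst
  have h1 := one_add_mul_self_le_rpow_one_add (s := s / t - 1)
    (by have := div_pos hs ht0; linarith) hα.le
  rw [show 1 + (s / t - 1) = s / t by ring, Real.div_rpow hs.le ht0.le,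
    le_div_iff₀ (Real.rpow_pos_of_pos ht0 _)] at h1
  have h2 : t ^ α * (α * (t - s) / t) ≤ α * (t - s) := by
    have : t ^ α = t ^ (α - 1) * t := by
      rw [Real.rpow_sub_one ht0.ne']; field_simp
    rw [this]
    have h3 : t ^ (α - 1) ≤ 1 := Real.rpow_le_one ht0.le ht (by linarith)
    have h4 : t ^ (α - 1) * t * (α * (t - s) / t) = t ^ (α - 1) * (α * (t - s)) := by
      field_simp
    rw [h4]
    have : 0 ≤ α * (t - s) := mul_nonneg (by linarith) (by linarith)
    nlinarith
  have h5 : (1 + α * (s / t - 1)) * t ^ α = t ^ α - t ^ α * (α * (t - s) / t) := by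
    field_simp; ring
  linarith

/-- Lower bound for the expansion of `t ↦ t^α`. -/
theorem rpow_sub_ge (hα : 1 < α) {s t : ℝ} (hs : 0 < s) (hst : s ≤ t) (hs1 : s ≤ 1) :
    s ^ α * (t - s) ≤ t ^ α - s ^ α := by
  have h1 := one_add_mul_self_le_rpow_one_add (s := t / s - 1)
    (by have : 1 ≤ t / s := by rw [le_div_iff₀ hs]; linarith
        linarith) hα.le
  rw [show 1 + (t / s - 1) = t / s by ring, Real.div_rpow (by linarith) hs.le,
    le_div_iff₀ (Real.rpow_pos_of_pos hs _)] at h1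
  have h2 : t - s ≤ α * (t / s - 1) := by
    have h3 : t / s - 1 = (t - s) / s := by field_simp
    have : t - s ≤ (t - s) / s := by rw [le_div_iff₀ hs]; nlinarith
    rw [h3]
    nlinarith
  nlinarith [Real.rpow_pos_of_pos hs α]

/-- Lower bound on the length of `C₋`. -/
theorem FlipCore.lower (h : FlipCore α M u v c l r a b F G) (hα : 1 < α) (hM : 1 ≤ M)
    (hc : c ≤ 1 / 2) : (c - l) / 2 ≤ (2 * α * M) ^ a * (M * ((c - l) / c) ^ α) := by
  have c0 := h.c0
  have key : ∀ i ≤ a, ∀ s ∈ Ico l c, ∀ s' ∈ Ico l c, s ≤ s' →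
      G^[i] (F s) ≤ G^[i] (F s') ∧ G^[i] (F s') ≤ 1 ∧
      G^[i] (F s') - G^[i] (F s) ≤ (2 * α * M) ^ i * (M * ((c - l) / c) ^ α) := by
    intro i
    induction i with
    | zero =>
      intro _ s hs s' hs' hss
      have l0 := h.l0
      have s0 : 0 ≤ s := l0.trans hs.1
      refine ⟨h.Fmono hα hM s0 hss hs'.2.le,
        (h.Fmono hα hM (s0.trans hss) hs'.2.le le_rfl).trans h.Fc1, ?_⟩
      simp only [iterate_zero, id_eq, pow_zero, one_mul]
      refine (h.A2 s s' s0 hss hs'.2.le).trans ?_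
      have h1 : ((c - s) / c) ^ α ≤ ((c - l) / c) ^ α := by
        apply Real.rpow_le_rpow (div_nonneg (by linarith [hs.2]) c0.le) _ (by linarith)
        gcongr
        exact hs.1
      have h2 : 0 ≤ ((c - s') / c) ^ α :=
        Real.rpow_nonneg (div_nonneg (by linarith [hs'.2]) c0.le) _
      have h3 : 0 ≤ ((c - l) / c) ^ α :=
        Real.rpow_nonneg (div_nonneg (by linarith [h.lc]) c0.le) _
      have := h.u0
      have := h.u1
      apply mul_le_mul_of_nonneg_left _ (by linarith)
      nlinarith
    | succ i ih =>
      intro hi s hs s' hs' hss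
      obtain ⟨i1, i2, i3⟩ := ih (by omega) s hs s' hs' hss
      have j1 := h.H1 i (by omega) s hs
      rw [iterate_succ_apply', iterate_succ_apply']
      set p := G^[i] (F s)
      set q := G^[i] (F s')
      refine ⟨h.Gmono hα hM j1.le i1 i2, ?_, ?_⟩
      · have := h.Gmono hα hM (j1.le.trans i1) i2 le_rfl
        rwa [h.G1] at this
      refine (h.B2 p q j1.le i1 i2).trans ?_
      have hc' : 0 < 1 - c := by linarith
      have h1 := rpow_sub_le hα (s := (p - c) / (1 - c)) (t := (q - c) / (1 - c))
        (div_nonneg (by linarith) hc'.le) (by gcongr) (by rw [div_le_one hc']; linarith)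
      have h2 : (q - c) / (1 - c) - (p - c) / (1 - c) ≤ 2 * (q - p) := by
        rw [← sub_div, div_le_iff₀ hc']
        nlinarith
      have h3 : v * (((q - c) / (1 - c)) ^ α - ((p - c) / (1 - c)) ^ α) ≤ α * (2 * (q - p)) := by
        have h4 : ((q - c) / (1 - c)) ^ α - ((p - c) / (1 - c)) ^ α ≤ α * (2 * (q - p)) :=
          h1.trans (mul_le_mul_of_nonneg_left h2 (by linarith))
        have h5 : 0 ≤ α * (2 * (q - p)) := mul_nonneg (by linarith) (by linarith)
        calc _ ≤ v * (α * (2 * (q - p))) := mul_le_mul_of_nonneg_left h4 h.v0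
          _ ≤ 1 * (α * (2 * (q - p))) := mul_le_mul_of_nonneg_right h.v1 h5
          _ = _ := one_mul _
      calc _ ≤ M * (α * (2 * (q - p))) := mul_le_mul_of_nonneg_left h3 (by linarith)
        _ = (2 * α * M) * (q - p) := by ring
        _ ≤ (2 * α * M) * ((2 * α * M) ^ i * (M * ((c - l) / c) ^ α)) := by
          apply mul_le_mul_of_nonneg_left i3
          nlinarith
        _ = _ := by ring
  have lc := h.lc
  obtain ⟨s, hs, hs2⟩ := h.H2 (show l ∈ Ico l c from ⟨le_rfl, lc⟩)
  obtain ⟨s', hs', hs2'⟩ := h.H2 (show (l + c) / 2 ∈ Ico l c from ⟨by linarith, by linarith⟩)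
  simp only at hs2 hs2'
  rcases le_total s s' with hh | hh
  · have := (key a le_rfl s hs s' hs' hh).2.2
    rw [hs2, hs2'] at this
    linarith
  · have := (key a le_rfl s' hs' s hs hh).1
    rw [hs2, hs2'] at this
    linarith

/-- Upper bound on the length of `C₊`, when `L = u / (2 M c) ≥ 1`. -/
theorem FlipCore.upper (h : FlipCore α M u v c l r a b F G) (hα : 1 < α) (hM : 1 ≤ M)
    (hc : c ≤ 1 / 2) (hL : 1 ≤ u / (2 * M * c)) (hb : 1 ≤ b) :
    (r - c) ^ α * (u / (2 * M * c)) ^ (b - 1) ≤ 4 * M ^ 2 := by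
  have c0 := h.c0
  have cr := h.cr
  have r1 := h.r1
  set L := u / (2 * M * c) with hLdef
  have hMc : 0 < 2 * M * c := by positivity
  have hu : 2 * M * c ≤ u := by rwa [hLdef, le_div_iff₀ hMc, one_mul] at hL
  have hu0 : 0 < u := hMc.trans_le hu
  have expand : ∀ z z', 0 ≤ z' → z' ≤ z → z ≤ c → F z < c → L * (z - z') ≤ F z - F z' := by
    intro z z' h0 hz hzc hF
    rcases hz.eq_or_lt with rfl | hlt
    · simp
    have h1 := h.A1 0 z le_rfl (h0.trans hz) hzc
    rw [h.F0, sub_zero, div_self c0.ne', Real.one_rpow, sub_zero] at h1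
    have h2 : 1 / 2 ≤ ((c - z) / c) ^ α := by
      by_contra hcon
      push Not at hcon
      have : u * (1 / 2) < u * (1 - ((c - z) / c) ^ α) := by
        apply mul_lt_mul_of_pos_left _ hu0; linarith
      have : M * F z < M * c := mul_lt_mul_of_pos_left hF (by linarith)
      linarith
    have hpos : 0 < (c - z) / c := by
      rcases hzc.eq_or_lt with rfl | h3
      · rw [sub_self, zero_div, Real.zero_rpow (by linarith)] at h2
        norm_num at h2
      · exact div_pos (by linarith) c0
    have h3 := rpow_sub_ge hα (s := (c - z) / c) (t := (c - z') / c) hpos (by gcongr)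
      (by rw [div_le_one c0]; linarith)
    have h4 : (c - z') / c - (c - z) / c = (z - z') / c := by ring
    rw [h4] at h3
    have h5 : 0 ≤ (z - z') / c := div_nonneg (by linarith) c0.le
    have h6 : 1 / 2 * ((z - z') / c) ≤ ((c - z') / c) ^ α - ((c - z) / c) ^ α := by
      refine le_trans ?_ h3
      exact mul_le_mul_of_nonneg_right h2 h5
    have h7 := h.A1 z' z h0 hz hzc
    have h8 : u * (1 / 2 * ((z - z') / c)) ≤ M * (F z - F z') :=
      (mul_le_mul_of_nonneg_left h6 hu0.le).trans h7
    have h9 : L * (z - z') = u * (1 / 2 * ((z - z') / c)) / M := by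
      rw [hLdef]; field_simp
    rw [h9, div_le_iff₀ (by linarith)]
    linarith
  set m := (c + r) / 2 with hm
  have hG0 : G m ≤ G r := h.Gmono hα hM (by linarith) (by linarith) r1
  have hGm : 0 ≤ G m := h.Gc0.trans (h.Gmono hα hM le_rfl (by linarith) (by linarith))
  have key : ∀ i < b, 0 ≤ F^[i] (G m) ∧ F^[i] (G m) ≤ F^[i] (G r) ∧
      L ^ i * (G r - G m) ≤ F^[i] (G r) - F^[i] (G m) := by
    intro i
    induction i with
    | zero => intro _; simp [hGm, hG0]
    | succ i ih =>
      intro hi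
      obtain ⟨i1, i2, i3⟩ := ih (by omega)
      have j1 := h.H3 i (by omega) r ⟨cr, le_rfl⟩
      have j2 := h.H3 (i + 1) hi r ⟨cr, le_rfl⟩
      rw [iterate_succ_apply'] at j2
      rw [iterate_succ_apply', iterate_succ_apply']
      set p := F^[i] (G m)
      set q := F^[i] (G r)
      refine ⟨?_, h.Fmono hα hM i1 i2 j1.le, ?_⟩
      · have := h.Fmono hα hM le_rfl i1 (i2.trans j1.le)
        rwa [h.F0] at this
      · refine le_trans ?_ (expand q p i1 i2 j1.le j2)
        rw [pow_succ]
        calc _ = L * (L ^ i * (G r - G m)) := by ring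
          _ ≤ _ := mul_le_mul_of_nonneg_left i3 (by linarith)
  obtain ⟨k1, k2, k3⟩ := key (b - 1) (by omega)
  have k4 := h.H3 (b - 1) (by omega) r ⟨cr, le_rfl⟩
  have k5 : L ^ (b - 1) * (G r - G m) ≤ 1 := by linarith
  have hc' : 0 < 1 - c := by linarith
  have hv : 1 / 2 ≤ M * v := by
    have := h.B2 c 1 le_rfl (by linarith) le_rfl
    rw [h.G1, div_self hc'.ne', sub_self, zero_div, Real.one_rpow,
      Real.zero_rpow (by linarith), sub_zero, mul_one] at this
    linarith [h.Gc]
  have hD : v * ((r - c) ^ α / 2) ≤ M * (G r - G m) := by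
    refine le_trans ?_ (h.B1 m r (by linarith) (by linarith) r1)
    apply mul_le_mul_of_nonneg_left _ h.v0
    have e1 : (m - c) / (1 - c) = (1 / 2) * ((r - c) / (1 - c)) := by rw [hm]; ring
    have hs : 0 ≤ (r - c) / (1 - c) := div_nonneg (by linarith) hc'.le
    rw [e1, Real.mul_rpow (by norm_num) hs]
    have e2 : (1 / 2 : ℝ) ^ α ≤ 1 / 2 := by
      have := Real.rpow_le_rpow_of_exponent_ge (x := (1 / 2 : ℝ)) (by norm_num) (by norm_num) hα.le
      rwa [Real.rpow_one] at this
    have e3 : (r - c) ^ α ≤ ((r - c) / (1 - c)) ^ α := by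
      apply Real.rpow_le_rpow (by linarith) _ (by linarith)
      rw [le_div_iff₀ hc']
      nlinarith
    have e4 : 0 ≤ ((r - c) / (1 - c)) ^ α := Real.rpow_nonneg hs _
    nlinarith
  have hy : 0 ≤ (r - c) ^ α := Real.rpow_nonneg (by linarith) _
  have hP : 0 ≤ L ^ (b - 1) := pow_nonneg (by linarith) _
  have g1 : (r - c) ^ α / 4 ≤ M ^ 2 * (G r - G m) := by
    calc (r - c) ^ α / 4 = 1 / 2 * ((r - c) ^ α / 2) := by ring
      _ ≤ M * v * ((r - c) ^ α / 2) := mul_le_mul_of_nonneg_right hv (by linarith)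
      _ = M * (v * ((r - c) ^ α / 2)) := by ring
      _ ≤ M * (M * (G r - G m)) := mul_le_mul_of_nonneg_left hD (by linarith)
      _ = _ := by ring
  have g2 : L ^ (b - 1) * ((r - c) ^ α / 4) ≤ L ^ (b - 1) * (M ^ 2 * (G r - G m)) :=
    mul_le_mul_of_nonneg_left g1 hP
  have g3 : M ^ 2 * (L ^ (b - 1) * (G r - G m)) ≤ M ^ 2 * 1 :=
    mul_le_mul_of_nonneg_left k5 (by positivity)
  nlinarith

/-- Lower bound on `u`. -/
theorem FlipCore.ubound (h : FlipCore α M u v c l r a b F G) (hα : 1 < α) (hM : 1 ≤ M)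
    (hc : c ≤ 1 / 2) (ha : 2 ≤ a) (hb : 2 ≤ b)
    (hsmall : 2 * M ^ 2 * (M * 2 ^ α) * (M ^ 2 * c) ^ (α - 1) ≤ 1) :
    c ≤ 2 * (M * 2 ^ α) * (M * u) ^ α := by
  have c0 := h.c0
  have lc := h.lc
  have cr := h.cr
  have r1 := h.r1
  have hc' : 0 < 1 - c := by linarith
  set w := F c with hw
  set e := G c with he
  have w1 : w ≤ 1 := h.Fc1
  have wc : c < w := h.Fc
  have e0 : 0 ≤ e := h.Gc0
  have ec : e < c := h.Gc
  have hGw : c < G w := by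
    have h1 := h.H1 0 (by omega) l ⟨le_rfl, lc⟩
    have h2 := h.H1 1 (by omega) l ⟨le_rfl, lc⟩
    simp only [iterate_zero, id_eq, iterate_one] at h1 h2
    exact h2.trans_le (h.Gmono hα hM h1.le (h.Fmono hα hM h.l0 lc.le le_rfl) w1)
  have hFe : F e < c := by
    have h1 := h.H3 0 (by omega) r ⟨cr, le_rfl⟩
    have h2 := h.H3 1 (by omega) r ⟨cr, le_rfl⟩
    simp only [iterate_zero, id_eq, iterate_one] at h1 h2
    exact (h.Fmono hα hM e0 (h.Gmono hα hM le_rfl cr.le r1) h1.le).trans_lt h2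
  set K := M * (2:ℝ) ^ α with hK
  have hKpos : 0 < K := by positivity
  set d := w - c with hd
  have d0 : 0 < d := by linarith
  -- `c - e < K d^α`
  have i1 : c - e < K * d ^ α := by
    have h1 := h.B2 c w le_rfl wc.le w1
    rw [sub_self, zero_div, Real.zero_rpow (by linarith), sub_zero] at h1
    have h2 : ((w - c) / (1 - c)) ^ α ≤ 2 ^ α * d ^ α := by
      rw [← Real.mul_rpow (by norm_num) d0.le]
      apply Real.rpow_le_rpow (div_nonneg d0.le hc'.le) _ (by linarith)
      rw [div_le_iff₀ hc']
      nlinarith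
    have h3 : v * ((w - c) / (1 - c)) ^ α ≤ 2 ^ α * d ^ α := by
      have : 0 ≤ ((w - c) / (1 - c)) ^ α := Real.rpow_nonneg (div_nonneg d0.le hc'.le) _
      nlinarith [h.v1]
    have h4 := mul_le_mul_of_nonneg_left h3 (show (0:ℝ) ≤ M by linarith)
    have h5 : M * (2 ^ α * d ^ α) = K * d ^ α := by rw [hK]; ring
    linarith
  set τ := (c - e) / c with hτ
  have τ0 : 0 < τ := div_pos (by linarith) c0
  have τ1 : τ ≤ 1 := by rw [hτ, div_le_one c0]; linarith
  have τα : τ ^ α ≤ τ := by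
    have := Real.rpow_le_rpow_of_exponent_ge τ0 τ1 hα.le
    rwa [Real.rpow_one] at this
  have hτc : τ * c = c - e := by rw [hτ]; field_simp
  rcases le_or_gt (τ ^ α) (1 / 2) with hcase | hcase
  · exfalso
    have h1 := h.A1 0 e le_rfl e0 ec.le
    rw [h.F0, sub_zero, div_self c0.ne', Real.one_rpow, sub_zero, ← hτ] at h1
    have hu : u ≤ 2 * (M * c) := by
      have : M * F e < M * c := mul_lt_mul_of_pos_left hFe (by linarith)
      nlinarith [h.u0]
    have h2 := h.A2 e c e0 ec.le le_rfl
    rw [sub_self, zero_div, Real.zero_rpow (by linarith), sub_zero, ← hτ, ← hw] at h2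
    have h3 : d < M * (2 * (M * c) * τ ^ α) := by
      have : u * τ ^ α ≤ 2 * (M * c) * τ ^ α :=
        mul_le_mul_of_nonneg_right hu (Real.rpow_nonneg τ0.le _)
      have := mul_le_mul_of_nonneg_left this (show (0:ℝ) ≤ M by linarith)
      linarith
    have h4 : d ≤ M ^ 2 * c := by
      have : M * (2 * (M * c) * τ ^ α) ≤ M * (2 * (M * c) * (1 / 2)) := by gcongr
      nlinarith
    have h5 : d < 2 * M ^ 2 * (K * d ^ α) := by
      have h6 : M * (2 * (M * c) * τ ^ α) ≤ M * (2 * (M * c) * τ) := by gcongr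
      have h7 : M * (2 * (M * c) * τ) = 2 * M ^ 2 * (τ * c) := by ring
      have h8 : 2 * M ^ 2 * (τ * c) ≤ 2 * M ^ 2 * (K * d ^ α) := by
        rw [hτc]; gcongr
      linarith
    have h9 : d ^ α = d ^ (α - 1) * d := by
      rw [Real.rpow_sub_one d0.ne']; field_simp
    have h10 : d ^ (α - 1) ≤ (M ^ 2 * c) ^ (α - 1) :=
      Real.rpow_le_rpow d0.le h4 (by linarith)
    have h11 : 2 * M ^ 2 * K * d ^ (α - 1) ≤ 1 := by
      refine le_trans ?_ hsmall
      gcongr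
    rw [h9] at h5
    nlinarith
  · have h1 : c < 2 * (K * d ^ α) := by
      have : 1 / 2 * c < τ * c := mul_lt_mul_of_pos_right (by linarith) c0
      linarith
    have h2 := h.A2 0 c le_rfl c0.le le_rfl
    rw [h.F0, sub_zero, sub_zero, div_self c0.ne', Real.one_rpow, sub_self, zero_div,
      Real.zero_rpow (by linarith), sub_zero, mul_one, ← hw] at h2
    have h3 : d ^ α ≤ (M * u) ^ α := Real.rpow_le_rpow d0.le (by linarith) (by linarith)
    have : K * d ^ α ≤ K * (M * u) ^ α := by gcongr
    linarith

end estimates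

set_option maxHeartbeats 1000000 in
theorem FlipCore.main (α M p σ : ℝ) (hα : 1 < α) (hM : 1 ≤ M) (hp : 0 < p) (hσ : 0 < σ)
    (hσ1 : σ < 1) :
    ∃ (N : ℕ) (γ : ℝ), 0 < γ ∧ ∀ (u v c l r : ℝ) (a b : ℕ) (F G : ℝ → ℝ),
      FlipCore α M u v c l r a b F G → N ≤ a → N ≤ b → (a : ℝ) ≤ p * b → c < γ →
      r - c < σ * c * (c - l) := by
  -- constants
  set θ := 1 - 1 / α with hθ
  have hα0 : 0 < α := by linarith
  have θ0 : 0 < θ := by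
    have : 1 / α < 1 := by rw [div_lt_one hα0]; exact hα
    linarith
  set β := α / (α - 1) with hβ
  have hα1 : 0 < α - 1 := by linarith
  have β0 : 0 < β := div_pos hα0 hα1
  have lM : 0 ≤ Real.log M := Real.log_nonneg hM
  set K := M * (2:ℝ) ^ α with hK
  have hKpos : 0 < K := by positivity
  have h2α : (1:ℝ) ≤ 2 ^ α := Real.one_le_rpow (by norm_num) hα0.le
  have hK1 : 1 ≤ K := by nlinarith
  set κ := Real.log (2 * K) / α + Real.log M + Real.log (2 * M) with hκ
  have κ0 : 0 ≤ κ := by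
    have := Real.log_nonneg (show (1:ℝ) ≤ 2 * K by linarith)
    have := Real.log_nonneg (show (1:ℝ) ≤ 2 * M by linarith)
    positivity
  set Q := Real.log (2 * α * M) with hQ
  have Q0 : 0 ≤ Q := Real.log_nonneg (by nlinarith)
  set C0 := Real.log (4 * M ^ 2) + β * Real.log (2 * M) - α * Real.log σ with hC0
  have C00 : 0 ≤ C0 := by
    have h1 := Real.log_nonneg (show (1:ℝ) ≤ 4 * M ^ 2 by nlinarith)
    have h2 := Real.log_nonneg (show (1:ℝ) ≤ 2 * M by linarith)
    have h3 := Real.log_nonpos hσ.le hσ1.le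
    have := mul_nonneg β0.le h2
    nlinarith
  set C1 := β * p * Q + κ with hC1
  have C10 : 0 ≤ C1 := by positivity
  -- N and the bound on Λ
  obtain ⟨N, hN⟩ := exists_nat_gt (2 + 2 * (α + α * β + θ) / θ)
  set T := max (κ / θ) (2 * (C0 + C1) / θ) with hT
  have ev : ∀ᶠ c in 𝓝[>] (0:ℝ), 2 * M ^ 2 * K * (M ^ 2 * c) ^ (α - 1) ≤ 1 ∧
      c ≤ 1 / 2 ∧ T < - Real.log c := by
    refine (Filter.Eventually.and ?_ (Filter.Eventually.and ?_ ?_))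
    · have : Tendsto (fun c : ℝ => 2 * M ^ 2 * K * (M ^ 2 * c) ^ (α - 1)) (𝓝 0)
          (𝓝 (2 * M ^ 2 * K * (M ^ 2 * 0) ^ (α - 1))) := by
        apply Tendsto.const_mul
        apply Tendsto.rpow_const
        · exact (continuous_const.mul continuous_id).tendsto 0
        · right; exact hα1.le
      rw [mul_zero, Real.zero_rpow hα1.ne', mul_zero] at this
      exact (this.mono_left nhdsWithin_le_nhds).eventually (eventually_le_nhds one_pos)
    · exact (eventually_le_nhds (by norm_num)).filter_mono nhdsWithin_le_nhds
    · exact (tendsto_neg_atBot_atTop.comp Real.tendsto_log_nhdsGT_zero).eventually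
        (eventually_gt_atTop T)
  rw [eventually_nhdsWithin_iff, Metric.eventually_nhds_iff] at ev
  obtain ⟨γ, γ0, hγ⟩ := ev
  refine ⟨N, γ, γ0, ?_⟩
  intro u v c l r a b F G h ha hb hab hcγ
  have c0 := h.c0
  obtain ⟨s1, s2, s3⟩ := hγ (y := c) (by rw [Real.dist_eq, sub_zero, abs_of_pos c0]; exact hcγ) c0
  have hN2 : 2 < (N : ℝ) := by
    have : 0 ≤ 2 * (α + α * β + θ) / θ := by positivity
    linarith
  have hN2' : 2 < N := by exact_mod_cast hN2
  by_contra hcon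
  push Not at hcon
  set Λ := - Real.log c with hΛ
  have hx : 0 < c - l := by linarith [h.lc]
  have hy : 0 < r - c := by linarith [h.cr]
  have hMpos : 0 < M := by linarith
  have hu := h.ubound hα hM s2 (by omega) (by omega) s1
  have u0 : 0 < u := by
    rcases h.u0.eq_or_lt with h0 | h0
    · rw [← h0, mul_zero, Real.zero_rpow (by linarith), mul_zero] at hu
      linarith
    · exact h0
  -- log of u
  have lu : -Λ ≤ Real.log (2 * K) + α * (Real.log M + Real.log u) := by
    have h1 := Real.log_le_log c0 hu
    rw [Real.log_mul (by positivity) (by positivity), Real.log_rpow (by positivity),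
      Real.log_mul hMpos.ne' u0.ne'] at h1
    rw [hΛ, neg_neg]
    exact h1
  set L := u / (2 * M * c) with hL
  have L0 : 0 < L := by positivity
  have lL : θ * Λ - κ ≤ Real.log L := by
    rw [hL, Real.log_div u0.ne' (by positivity), Real.log_mul (by positivity) c0.ne']
    have : -Λ / α ≤ Real.log (2 * K) / α + (Real.log M + Real.log u) := by
      rw [div_le_iff₀ hα0, add_mul, div_mul_cancel₀ _ hα0.ne']
      linarith
    have e : θ * Λ = Λ + -Λ / α := by rw [hθ]; ring
    rw [e]
    linarith
  have T1 : κ < θ * Λ := by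
    have : κ / θ < Λ := (le_max_left _ _).trans_lt s3
    rw [div_lt_iff₀ θ0] at this
    linarith
  have T2 : 2 * (C0 + C1) < θ * Λ := by
    have : 2 * (C0 + C1) / θ < Λ := (le_max_right _ _).trans_lt s3
    rw [div_lt_iff₀ θ0] at this
    linarith
  have L1 : 1 ≤ L := by
    have : 0 < Real.log L := by linarith
    rw [Real.log_pos_iff L0.le] at this
    exact this.le
  have up := h.upper hα hM s2 L1 (by omega)
  have lo := h.lower hα hM s2
  have bb : ((b - 1 : ℕ) : ℝ) = (b : ℝ) - 1 := by
    rw [Nat.cast_sub (by omega)]; simp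
  have lup : α * Real.log (r - c) + ((b : ℝ) - 1) * Real.log L ≤ Real.log (4 * M ^ 2) := by
    have := Real.log_le_log (by positivity) up
    rwa [Real.log_mul (by positivity) (by positivity), Real.log_rpow hy, Real.log_pow, bb] at this
  have llo : Real.log (c - l) ≤
      Real.log (2 * M) + a * Q + α * (Real.log (c - l) + Λ) := by
    have h1 : c - l ≤ (2 * M) * ((2 * α * M) ^ a * ((c - l) / c) ^ α) := by
      have e : (2 * M) * ((2 * α * M) ^ a * ((c - l) / c) ^ α) =
        2 * ((2 * α * M) ^ a * (M * ((c - l) / c) ^ α)) := by ring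
      rw [e]
      linarith only [lo]
    have := Real.log_le_log hx h1
    rw [Real.log_mul (x := 2 * M) (by positivity) (by positivity),
      Real.log_mul (x := (2 * α * M) ^ a) (by positivity) (by positivity),
      Real.log_rpow (by positivity), Real.log_pow, Real.log_div hx.ne' c0.ne'] at this
    rw [hΛ]
    linarith
  have lc : Real.log σ - Λ + Real.log (c - l) ≤ Real.log (r - c) := by
    have := Real.log_le_log (by positivity) hcon
    rw [Real.log_mul (by positivity) (by positivity), Real.log_mul (by positivity) (by positivity)]
      at this
    rw [hΛ]
    linarith
  -- combine
  set X := Real.log (c - l)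
  set Y := Real.log (r - c)
  have m1 : -(β * (Real.log (2 * M) + a * Q + α * Λ)) ≤ α * X := by
    have h1 : -(Real.log (2 * M) + a * Q + α * Λ) ≤ (α - 1) * X := by linarith
    have h2 := mul_le_mul_of_nonneg_left h1 β0.le
    have h3 : β * ((α - 1) * X) = α * X := by rw [hβ]; field_simp
    linarith
  have m2 : α * (Real.log σ - Λ + X) ≤ α * Y := mul_le_mul_of_nonneg_left lc hα0.le
  have hbN : (N : ℝ) ≤ b := by exact_mod_cast hb
  have m3 : ((b : ℝ) - 1) * (θ * Λ - κ) ≤ ((b : ℝ) - 1) * Real.log L :=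
    mul_le_mul_of_nonneg_left lL (by linarith)
  have m4 : (a : ℝ) * (β * Q) ≤ p * b * (β * Q) :=
    mul_le_mul_of_nonneg_right hab (by positivity)
  have Λ0 : 0 < Λ := by
    have : 0 < θ * Λ := by linarith only [T1, κ0]
    exact pos_of_mul_pos_right this θ0.le
  have m5 : ((b : ℝ) - 1) * (θ * Λ) ≤ C0 + C1 * b + (α + α * β) * Λ := by
    rw [hC0, hC1]
    linarith only [lup, m1, m2, m3, m4, κ0]
  have m6 : 2 * (α + α * β + θ) ≤ b * θ := by
    have : 2 * (α + α * β + θ) / θ < b := by linarith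
    rw [div_lt_iff₀ θ0] at this
    exact this.le
  have m7 : (α + α * β + θ) * Λ ≤ b * θ / 2 * Λ :=
    mul_le_mul_of_nonneg_right (by linarith) Λ0.le
  have m8 : (b : ℝ) / 2 * (θ * Λ) ≤ C0 + C1 * b := by linarith only [m5, m7]
  have m9 : (b : ℝ) / 2 * (2 * (C0 + C1)) < b / 2 * (θ * Λ) :=
    mul_lt_mul_of_pos_left T2 (by linarith)
  have m10 : C0 * 1 ≤ C0 * b := mul_le_mul_of_nonneg_left (by linarith only [hbN, hN2]) C00
  linarith only [m8, m9, m10]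

/-- Bi-Lipschitz bounds for diffeomorphisms of bounded nonlinearity. -/
theorem IsSDiffeo.bilip {φ : ℝ → ℝ} (h : IsSDiffeo φ) {δ : ℝ} (hδ : diffeoNorm φ < δ) :
    ∀ x y, 0 ≤ x → x ≤ y → y ≤ 1 →
      y - x ≤ Real.exp |δ| * (φ y - φ x) ∧ φ y - φ x ≤ Real.exp |δ| * (y - x) := by
  have hU : UniqueDiffOn ℝ (Icc (0:ℝ) 1) := uniqueDiffOn_Icc one_pos
  have hdiff : ∀ x ∈ Icc (0:ℝ) 1, DifferentiableAt ℝ φ x := fun x hx =>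
    differentiableAt_of_deriv_ne_zero (h.derivPos x hx).ne'
  have hdw : ∀ x ∈ Icc (0:ℝ) 1, derivWithin φ (Icc 0 1) x = deriv φ x := fun x hx =>
    (hdiff x hx).derivWithin (hU x hx)
  have c2 : ContDiffOn ℝ 2 (derivWithin φ (Icc 0 1)) (Icc 0 1) :=
    h.contDiff.derivWithin hU (by norm_num)
  have c1 : ContDiffOn ℝ 1 (derivWithin (derivWithin φ (Icc 0 1)) (Icc 0 1)) (Icc 0 1) :=
    c2.derivWithin hU (by norm_num)
  have hd2 : ∀ x ∈ Ioo (0:ℝ) 1,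
      HasDerivAt (deriv φ) (derivWithin (derivWithin φ (Icc 0 1)) (Icc 0 1) x) x := by
    intro x hx
    have hn : Icc (0:ℝ) 1 ∈ 𝓝 x := Icc_mem_nhds hx.1 hx.2
    have h1 : HasDerivAt (derivWithin φ (Icc 0 1))
        (derivWithin (derivWithin φ (Icc 0 1)) (Icc 0 1) x) x :=
      ((c2.differentiableOn (by norm_num)) x (Ioo_subset_Icc_self hx)).hasDerivWithinAt.hasDerivAt hn
    refine h1.congr_of_eventuallyEq ?_
    filter_upwards [hn] with y hy
    exact (hdw y hy).symm
  have hN : ∀ x ∈ Ioo (0:ℝ) 1, nonlinearity φ x =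
      derivWithin (derivWithin φ (Icc 0 1)) (Icc 0 1) x / derivWithin φ (Icc 0 1) x := by
    intro x hx
    rw [nonlinearity, (hd2 x hx).deriv, hdw x (Ioo_subset_Icc_self hx)]
  have hbdd : BddAbove ((fun x => |nonlinearity φ x|) '' Icc 0 1) := by
    have hc : ContinuousOn (fun x => |derivWithin (derivWithin φ (Icc 0 1)) (Icc 0 1) x /
        derivWithin φ (Icc 0 1) x|) (Icc (0:ℝ) 1) := by
      apply ContinuousOn.abs
      apply c1.continuousOn.div c2.continuousOn
      intro x hx
      rw [hdw x hx]
      exact (h.derivPos x hx).ne'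
    obtain ⟨B, hB⟩ := (isCompact_Icc.image_of_continuousOn hc).bddAbove
    refine ⟨max B (max |nonlinearity φ 0| |nonlinearity φ 1|), ?_⟩
    rintro _ ⟨x, hx, rfl⟩
    rcases hx.1.eq_or_lt with h0 | h0
    · rw [← h0]; exact (le_max_left _ _).trans (le_max_right _ _)
    rcases hx.2.eq_or_lt with h1 | h1
    · rw [h1]; exact (le_max_right _ _).trans (le_max_right _ _)
    refine le_trans ?_ (le_max_left _ _)
    simp only
    rw [hN x ⟨h0, h1⟩]
    exact hB ⟨x, hx, rfl⟩
  have hNb : ∀ x ∈ Ioo (0:ℝ) 1, |nonlinearity φ x| ≤ |δ| := by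
    intro x hx
    have : |nonlinearity φ x| ≤ diffeoNorm φ :=
      le_csSup hbdd ⟨x, Ioo_subset_Icc_self hx, rfl⟩
    exact (this.trans hδ.le).trans (le_abs_self δ)
  have hcont : ContinuousOn φ (Icc 0 1) := h.contDiff.continuousOn
  obtain ⟨ξ, hξ, hξ1⟩ := exists_deriv_eq_slope φ one_pos hcont
    (fun x hx => (hdiff x (Ioo_subset_Icc_self hx)).differentiableWithinAt)
  rw [h.fix0, h.fix1] at hξ1
  norm_num at hξ1
  have hlog : ∀ x ∈ Ioo (0:ℝ) 1, |Real.log (deriv φ x)| ≤ |δ| := by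
    intro x hx
    have := (convex_Ioo (0:ℝ) 1).norm_image_sub_le_of_norm_hasDerivWithin_le
      (f := fun x => Real.log (deriv φ x)) (f' := fun x => nonlinearity φ x) (C := |δ|)
      (fun y hy => by
        have h1 := (hd2 y hy).log (h.derivPos y (Ioo_subset_Icc_self hy)).ne'
        rw [← hdw y (Ioo_subset_Icc_self hy), ← hN y hy] at h1
        exact h1.hasDerivWithinAt)
      (fun y hy => hNb y hy) hξ hx
    rw [hξ1, Real.log_one, sub_zero, Real.norm_eq_abs, Real.norm_eq_abs] at this
    refine this.trans ?_
    have : |x - ξ| ≤ 1 := by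
      rw [abs_le]; constructor <;> linarith [hx.1, hx.2, hξ.1, hξ.2]
    nlinarith [abs_nonneg δ]
  intro x y hx hxy hy
  rcases hxy.eq_or_lt with rfl | hlt
  · simp
  obtain ⟨z, hz, hz1⟩ := exists_deriv_eq_slope φ hlt
    (hcont.mono (Icc_subset_Icc hx hy))
    (fun t ht => (hdiff t ⟨by linarith [ht.1], by linarith [ht.2]⟩).differentiableWithinAt)
  have hz01 : z ∈ Ioo (0:ℝ) 1 := ⟨by linarith [hz.1], by linarith [hz.2]⟩
  have hzp := h.derivPos z (Ioo_subset_Icc_self hz01)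
  have hl := abs_le.1 (hlog z hz01)
  have u1 : deriv φ z ≤ Real.exp |δ| := (Real.log_le_iff_le_exp hzp).1 hl.2
  have u2 : Real.exp (-|δ|) ≤ deriv φ z := (Real.le_log_iff_exp_le hzp).1 hl.1
  have hxy' : 0 < y - x := by linarith
  have e : φ y - φ x = deriv φ z * (y - x) := by rw [hz1]; field_simp
  rw [e]
  refine ⟨?_, mul_le_mul_of_nonneg_right u1 hxy'.le⟩
  have : 1 ≤ Real.exp |δ| * deriv φ z := by
    calc (1:ℝ) = Real.exp |δ| * Real.exp (-|δ|) := by rw [← Real.exp_add]; simp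
      _ ≤ _ := mul_le_mul_of_nonneg_left u2 (Real.exp_pos _).le
  nlinarith

theorem flipCore_of_lorenz {α δ : ℝ} (hα : 1 < α) (f : LorenzMap α) (a b : ℕ) (l r : ℝ)
    (hf : f.memL δ) (l0 : 0 ≤ l) (lc : l < f.c) (cr : f.c < r) (r1 : r ≤ 1)
    (hab : ABCombinatorics f l r a b) :
    FlipCore α (Real.exp |δ|) f.u f.v f.c l r a b f.fm f.fp := by
  have c0 := f.hc.1
  have c1 := f.hc.2
  have u0 := f.hu.1
  have u1 := f.hu.2
  have v0 := f.hv.1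
  have v1 := f.hv.2
  have hc' : 0 < 1 - f.c := by linarith
  have hφ := f.hφ.bilip hf.1
  have hψ := f.hψ.bilip hf.2
  obtain ⟨-, -, h1, -, h2, -, h3, -, h4, -⟩ := hab
  have it1 : ∀ i ≤ a, ∀ x ∈ Ico l f.c, f.toFun^[i + 1] x = f.fp^[i] (f.fm x) := by
    intro i
    induction i with
    | zero => intro _ x hx; simp [LorenzMap.toFun, hx.2]
    | succ i ih =>
      intro hi x hx
      have := h1 (i + 1) (by omega) hi x hx
      rw [iterate_succ_apply', iterate_succ_apply' f.fp, ← ih (by omega) x hx]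
      rw [LorenzMap.toFun, if_neg (not_lt.2 this.le)]
  have it2 : ∀ i ≤ b, ∀ x ∈ Ioc f.c r, f.toFun^[i + 1] x = f.fm^[i] (f.fp x) := by
    intro i
    induction i with
    | zero => intro _ x hx; simp [LorenzMap.toFun, hx.1.le]
    | succ i ih =>
      intro hi x hx
      have := h3 (i + 1) (by omega) hi x hx
      rw [iterate_succ_apply', iterate_succ_apply' f.fm, ← ih (by omega) x hx]
      rw [LorenzMap.toFun, if_pos this]
  have qm : ∀ x, x ≤ f.c → qminus α f.u f.c x = f.u * (1 - ((f.c - x) / f.c) ^ α) := by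
    intro x hx
    rw [qminus, abs_of_nonneg (div_nonneg (by linarith) c0.le)]
  have qp : ∀ x, f.c ≤ x → qplus α f.v f.c x =
      1 + f.v * (-1 + ((x - f.c) / (1 - f.c)) ^ α) := by
    intro x hx
    rw [qplus, abs_of_nonneg (div_nonneg (by linarith) hc'.le)]
  have tm : ∀ x, 0 ≤ x → x ≤ f.c →
      0 ≤ ((f.c - x) / f.c) ^ α ∧ ((f.c - x) / f.c) ^ α ≤ 1 := by
    intro x hx hxc
    have : 0 ≤ (f.c - x) / f.c := div_nonneg (by linarith) c0.le
    exact ⟨Real.rpow_nonneg this _,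
      Real.rpow_le_one this (by rw [div_le_one c0]; linarith) (by linarith)⟩
  have tp : ∀ x, f.c ≤ x → x ≤ 1 →
      0 ≤ ((x - f.c) / (1 - f.c)) ^ α ∧ ((x - f.c) / (1 - f.c)) ^ α ≤ 1 := by
    intro x hx hxc
    have : 0 ≤ (x - f.c) / (1 - f.c) := div_nonneg (by linarith) hc'.le
    exact ⟨Real.rpow_nonneg this _,
      Real.rpow_le_one this (by rw [div_le_one hc']; linarith) (by linarith)⟩
  have A : ∀ x y, 0 ≤ x → x ≤ y → y ≤ f.c →
      f.u * (((f.c - x) / f.c) ^ α - ((f.c - y) / f.c) ^ α) ≤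
        Real.exp |δ| * (f.fm y - f.fm x) ∧
      f.fm y - f.fm x ≤
        Real.exp |δ| * (f.u * (((f.c - x) / f.c) ^ α - ((f.c - y) / f.c) ^ α)) := by
    intro x y hx hxy hy
    have m : ((f.c - y) / f.c) ^ α ≤ ((f.c - x) / f.c) ^ α := by
      apply Real.rpow_le_rpow (div_nonneg (by linarith) c0.le) _ (by linarith)
      gcongr
    obtain ⟨t1, t2⟩ := tm x hx (by linarith)
    obtain ⟨t3, t4⟩ := tm y (by linarith) hy
    have := hφ (qminus α f.u f.c x) (qminus α f.u f.c y)
      (by rw [qm x (by linarith)]; exact mul_nonneg u0 (by linarith))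
      (by rw [qm x (by linarith), qm y hy]; exact mul_le_mul_of_nonneg_left (by linarith) u0)
      (by rw [qm y hy]; nlinarith)
    have e : qminus α f.u f.c y - qminus α f.u f.c x =
        f.u * (((f.c - x) / f.c) ^ α - ((f.c - y) / f.c) ^ α) := by
      rw [qm x (by linarith), qm y hy]; ring
    rw [e] at this
    exact this
  have B : ∀ x y, f.c ≤ x → x ≤ y → y ≤ 1 →
      f.v * (((y - f.c) / (1 - f.c)) ^ α - ((x - f.c) / (1 - f.c)) ^ α) ≤
        Real.exp |δ| * (f.fp y - f.fp x) ∧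
      f.fp y - f.fp x ≤
        Real.exp |δ| * (f.v * (((y - f.c) / (1 - f.c)) ^ α - ((x - f.c) / (1 - f.c)) ^ α)) := by
    intro x y hx hxy hy
    have m : ((x - f.c) / (1 - f.c)) ^ α ≤ ((y - f.c) / (1 - f.c)) ^ α := by
      apply Real.rpow_le_rpow (div_nonneg (by linarith) hc'.le) _ (by linarith)
      gcongr
    obtain ⟨t1, t2⟩ := tp x hx (by linarith)
    obtain ⟨t3, t4⟩ := tp y (by linarith) hy
    have e : qplus α f.v f.c y - qplus α f.v f.c x =
        f.v * (((y - f.c) / (1 - f.c)) ^ α - ((x - f.c) / (1 - f.c)) ^ α) := by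
      rw [qp x hx, qp y (by linarith)]; ring
    have := hψ (qplus α f.v f.c x) (qplus α f.v f.c y)
      (by rw [qp x hx]; nlinarith)
      (by rw [← sub_nonneg, e]; exact mul_nonneg v0 (by linarith))
      (by rw [qp y (by linarith)]; nlinarith)
    rw [e] at this
    exact this
  have fmc : f.fm f.c = f.φ f.u := by
    rw [LorenzMap.fm, qm _ le_rfl, sub_self, zero_div, Real.zero_rpow (by linarith)]; simp
  have fpc : f.fp f.c = f.ψ (1 - f.v) := by
    rw [LorenzMap.fp, qp _ le_rfl, sub_self, zero_div, Real.zero_rpow (by linarith)]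
    congr 1; ring
  have E0 : 0 < Real.exp |δ| := Real.exp_pos _
  exact
  { u0 := u0, u1 := u1, v0 := v0, v1 := v1, c0 := c0, c1 := c1, l0 := l0, lc := lc, cr := cr
    r1 := r1
    F0 := by
      rw [LorenzMap.fm, qm _ c0.le, sub_zero, div_self c0.ne', Real.one_rpow, sub_self, mul_zero]
      exact f.hφ.fix0
    Fc1 := by
      have := (hφ f.u 1 u0 u1 le_rfl).1
      have h5 : 0 ≤ Real.exp |δ| * (f.φ 1 - f.φ f.u) := le_trans (by linarith) this
      have := nonneg_of_mul_nonneg_right h5 E0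
      rw [f.hφ.fix1] at this
      rw [fmc]; linarith
    Fc := f.hleft f.c ⟨c0, le_rfl⟩
    G1 := by
      rw [LorenzMap.fp, qp _ c1.le, div_self hc'.ne', Real.one_rpow]
      simp [f.hψ.fix1]
    Gc0 := by
      have := (hψ 0 (1 - f.v) le_rfl (by linarith) (by linarith)).1
      have h5 : 0 ≤ Real.exp |δ| * (f.ψ (1 - f.v) - f.ψ 0) := le_trans (by linarith) this
      have := nonneg_of_mul_nonneg_right h5 E0
      rw [f.hψ.fix0] at this
      rw [fpc]; linarith
    Gc := f.hright f.c ⟨le_rfl, c1⟩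
    A1 := fun x y hx hxy hy => (A x y hx hxy hy).1
    A2 := fun x y hx hxy hy => (A x y hx hxy hy).2
    B1 := fun x y hx hxy hy => (B x y hx hxy hy).1
    B2 := fun x y hx hxy hy => (B x y hx hxy hy).2
    H1 := by
      intro i hi x hx
      rw [← it1 i hi.le x hx]
      exact h1 (i + 1) (by omega) (by omega) x hx
    H2 := by
      intro t ht
      obtain ⟨x, hx, hxt⟩ := h2 ht
      exact ⟨x, hx, by rw [← hxt]; exact (it1 a le_rfl x hx).symm⟩
    H3 := by
      intro i hi x hx
      rw [← it2 i hi.le x hx]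
      exact h3 (i + 1) (by omega) (by omega) x hx
    H4 := by
      intro t ht
      obtain ⟨x, hx, hxt⟩ := h4 ht
      exact ⟨x, hx, by rw [← hxt]; exact (it2 b le_rfl x hx).symm⟩ }

/-- **Flipping Lemma.** For every compact interval `P = [p₁,p₂] ⊂ (0,∞)`, `δ < ∞`
and `σ ∈ (0,1)` there exist `N < ∞` and `γ > 0` such that if `f ∈ L_δ` is
`(a,b)`-renormalizable with `min{a,b} ≥ N` and `a/b ∈ P`, then: if `c(f) < γ` then
`1 - c(Rf) < σ c(f)`, and if `1 - c(f) < γ` then `c(Rf) < σ (1 - c(f))`. -/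
theorem flipping_lemma (α : ℝ) (hα : 1 < α) (p₁ p₂ : ℝ) (hp₁ : 0 < p₁) (hp : p₁ ≤ p₂)
    (δ σ : ℝ) (hσ : σ ∈ Set.Ioo (0:ℝ) 1) :
    ∃ (N : ℕ) (γ : ℝ), 0 < γ ∧ ∀ (f g : LorenzMap α) (a b : ℕ) (l r : ℝ),
      f.memL δ → IsReturnInterval f l r → IsRenormPair f g l r →
      ABCombinatorics f l r a b → N ≤ min a b →
      p₁ ≤ (a : ℝ) / b → (a : ℝ) / b ≤ p₂ →
      (f.c < γ → 1 - g.c < σ * f.c) ∧ (1 - f.c < γ → g.c < σ * (1 - f.c)) := by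
  have hM : 1 ≤ Real.exp |δ| := Real.one_le_exp (abs_nonneg _)
  obtain ⟨N1, γ1, hγ1, H1⟩ := FlipCore.main α (Real.exp |δ|) p₂ σ hα hM (by linarith) hσ.1 hσ.2
  obtain ⟨N2, γ2, hγ2, H2⟩ := FlipCore.main α (Real.exp |δ|) (1 / p₁) σ hα hM (by positivity)
    hσ.1 hσ.2
  refine ⟨max N1 N2, min γ1 γ2, lt_min hγ1 hγ2, ?_⟩
  intro f g a b l r hf _ hg hab hN hP1 hP2
  obtain ⟨l0, lc, cr, r1, -, hgc, -⟩ := hg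
  have core := flipCore_of_lorenz hα f a b l r hf l0 lc cr r1 hab
  have b0 : (0:ℝ) < b := by exact_mod_cast hab.2.1
  have a1 : (a : ℝ) ≤ p₂ * b := by rwa [div_le_iff₀ b0] at hP2
  have a2 : (b : ℝ) ≤ 1 / p₁ * a := by
    rw [le_div_iff₀ b0] at hP1
    rw [one_div, inv_mul_eq_div, le_div_iff₀ hp₁]
    linarith
  have hlr : 0 < r - l := by linarith
  have c0 := f.hc.1
  have c1 := f.hc.2
  have s0 := hσ.1
  have n1 : N1 ≤ a := by omega
  have n2 : N1 ≤ b := by omega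
  have n3 : N2 ≤ a := by omega
  have n4 : N2 ≤ b := by omega
  constructor
  · intro hc
    have := H1 _ _ _ _ _ _ _ _ _ core n1 n2 a1 (hc.trans_le (min_le_left _ _))
    have e : 1 - g.c = (r - f.c) / (r - l) := by rw [hgc]; field_simp; ring
    rw [e, div_lt_iff₀ hlr]
    refine this.trans ?_
    apply mul_lt_mul_of_pos_left _ (by positivity)
    linarith
  · intro hc
    have := H2 _ _ _ _ _ _ _ _ _ core.flip n4 n3 a2 (hc.trans_le (min_le_right _ _))
    rw [hgc, div_lt_iff₀ hlr]
    have e : 0 < σ * (1 - f.c) := mul_pos s0 (by linarith)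
    have e2 : σ * (1 - f.c) * (1 - f.c - (1 - r)) < σ * (1 - f.c) * (r - l) :=
      mul_lt_mul_of_pos_left (by linarith) e
    linarith
end
end
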